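/- arXiv:2604.11980 — 4 statements merged into one kernel-verified Lean document; each statement's English description precedes it below -/
import Mathlib

section
/- Let (X,𝔙) be an iterated function system. Then mdim(X,𝔙) ≤ lmdim(X,𝔙) ≤ umdim(X,𝔙). -/
open Filter Topology Set
open scoped ENat ENNReal

/-- A member map of a generalized iterated function system: a homeomorphism
`v : D(v) → v(D(v))` with closed domain `D(v) ⊆ X`. (On a compact metric space,
a continuous injective map on a closed domain is automatically a homeomorphism
onto its image.) -/
structure IFSMap (X : Type*) [MetricSpace X] where
  dom : Set X
  toFun : X → X
  closed_dom : IsClosed dom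
  injOn : Set.InjOn toFun dom
  contOn : ContinuousOn toFun dom

namespace IFS

variable {X : Type*} [MetricSpace X]

/-- `(X, 𝔙)` is an iterated function system: there is `O ⊆ X` with
`∅ ≠ ⋃_{v∈𝔙} v(D(v)∩O) ⊆ ⋃_{v∈𝔙} (D(v)∩O)`. -/
def IsIFS (𝔙 : Set (IFSMap X)) : Prop :=
  ∃ O : Set X, (⋃ v ∈ 𝔙, v.toFun '' (v.dom ∩ O)).Nonempty ∧
    (⋃ v ∈ 𝔙, v.toFun '' (v.dom ∩ O)) ⊆ ⋃ v ∈ 𝔙, (v.dom ∩ O)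

/-- `orbitIter σ x n = v^{σ(n)}(x) = v_n ∘ ⋯ ∘ v_1 (x)` (here `σ 0 = v_1`). -/
def orbitIter (σ : ℕ → IFSMap X) (x : X) : ℕ → X
  | 0 => x
  | n + 1 => (σ n).toFun (orbitIter σ x n)

/-- `σ ∈ Σ_x` and `x ∈ Σ_σ` : `v^{σ(n)}(x)` is well defined for all `n`. -/
def WellDef (σ : ℕ → IFSMap X) (x : X) : Prop := ∀ n : ℕ, orbitIter σ x n ∈ (σ n).dom

/-- `σ ∈ Σ`, i.e. `σ` is a sequence of members of `𝔙`. -/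
def SeqIn (𝔙 : Set (IFSMap X)) (σ : ℕ → IFSMap X) : Prop := ∀ n : ℕ, σ n ∈ 𝔙

/-- `Σ_σ = {x ∈ X : v^{σ(n)}(x) is well defined for all n}`. -/
def SigmaSet (σ : ℕ → IFSMap X) : Set X := {x | WellDef σ x}

/-! ### Spanning sets, entropy and metric mean dimension -/

/-- `R` is an `(n,ε)`-spanning subset of `Ψ(X)`. -/
def IsSpanning (𝔙 : Set (IFSMap X)) (n : ℕ) (ε : ℝ) (R : Set (X × (ℕ → IFSMap X))) : Prop :=
  (∀ p ∈ R, SeqIn 𝔙 p.2 ∧ WellDef p.2 p.1) ∧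
  ∀ (x : X) (σ : ℕ → IFSMap X), SeqIn 𝔙 σ → WellDef σ x →
    ∃ p ∈ R, ∀ i < n, dist (orbitIter σ x i) (orbitIter p.2 p.1 i) < ε

/-- `r(n,ε)`: minimal cardinality of an `(n,ε)`-spanning set. -/
noncomputable def spanNum (𝔙 : Set (IFSMap X)) (n : ℕ) (ε : ℝ) : ℝ≥0∞ :=
  ⨅ (R : Set (X × (ℕ → IFSMap X))) (_ : IsSpanning 𝔙 n ε R), (R.encard : ℝ≥0∞)

/-- `limsup_{n→∞} (1/n) log r(n,ε)`. -/
noncomputable def entropyRate (𝔙 : Set (IFSMap X)) (ε : ℝ) : EReal :=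
  limsup (fun n : ℕ => (((n : ℝ)⁻¹ : ℝ) : EReal) * ENNReal.log (spanNum 𝔙 n ε)) atTop

/-- Topological entropy `h(X,𝔙) = lim_{ε→0} limsup_{n→∞} (1/n) log r(n,ε)`; since the
inner quantity is antitone in `ε`, the limit is the supremum over `ε > 0`. -/
noncomputable def entropy (𝔙 : Set (IFSMap X)) : EReal :=
  ⨆ (ε : ℝ) (_ : 0 < ε), entropyRate 𝔙 ε

/-- Upper metric mean dimension. -/
noncomputable def umdim (𝔙 : Set (IFSMap X)) : EReal :=
  limsup (fun ε : ℝ => ((|Real.log ε|⁻¹ : ℝ) : EReal) * entropyRate 𝔙 ε) (𝓝[>] (0 : ℝ))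

/-- Lower metric mean dimension. -/
noncomputable def lmdim (𝔙 : Set (IFSMap X)) : EReal :=
  liminf (fun ε : ℝ => ((|Real.log ε|⁻¹ : ℝ) : EReal) * entropyRate 𝔙 ε) (𝓝[>] (0 : ℝ))

/-! ### Separated sets and orbit metric mean dimension -/

/-- `S` is `(σ,n,ε)`-separated. -/
def IsSeparatedAlong (σ : ℕ → IFSMap X) (n : ℕ) (ε : ℝ) (S : Set X) : Prop :=
  (∀ x ∈ S, WellDef σ x) ∧
  ∀ x ∈ S, ∀ y ∈ S, x ≠ y → ∃ i < n, ε ≤ dist (orbitIter σ x i) (orbitIter σ y i)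

/-- `s(σ,n,ε)`: maximal cardinality of a `(σ,n,ε)`-separated set. -/
noncomputable def sepNum (σ : ℕ → IFSMap X) (n : ℕ) (ε : ℝ) : ℝ≥0∞ :=
  ⨆ (S : Set X) (_ : IsSeparatedAlong σ n ε S), (S.encard : ℝ≥0∞)

/-- Orbit metric mean dimension of `(X,𝔙)` along `σ`. -/
noncomputable def omdimAlong (σ : ℕ → IFSMap X) : EReal :=
  liminf (fun ε : ℝ => ((|Real.log ε|⁻¹ : ℝ) : EReal) *
    limsup (fun n : ℕ => (((n : ℝ)⁻¹ : ℝ) : EReal) * ENNReal.log (sepNum σ n ε)) atTop)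
    (𝓝[>] (0 : ℝ))

/-- Orbit metric mean dimension of `(X,𝔙)`. -/
noncomputable def omdim (𝔙 : Set (IFSMap X)) : EReal :=
  ⨆ (σ : ℕ → IFSMap X) (_ : SeqIn 𝔙 σ), omdimAlong σ

/-! ### Finite open covers and mean dimension -/

/-- `α` is a finite open cover of `A` (elements open relative to `A`). -/
def IsOpenCoverOn (A : Set X) (α : Set (Set X)) : Prop :=
  α.Finite ∧ (∀ U ∈ α, ∃ V : Set X, IsOpen V ∧ U ∩ A = V ∩ A) ∧ A ⊆ ⋃₀ α

/-- `β` refines `α`. -/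
def Refines (β α : Set (Set X)) : Prop := ∀ U ∈ β, ∃ V ∈ α, U ⊆ V

/-- `ord(α,A) = max_{x∈A} Σ_{U∈α} 1_U(x) − 1`. -/
noncomputable def ordOn (A : Set X) (α : Set (Set X)) : ℕ∞ :=
  (⨆ x ∈ A, {U ∈ α | x ∈ U}.encard) - 1

/-- `𝒟(α) = min_{β ≻ α} ord(β,A)` over finite open covers `β` of `A` refining `α`. -/
noncomputable def coverD (A : Set X) (α : Set (Set X)) : ℕ∞ :=
  ⨅ (β : Set (Set X)) (_ : IsOpenCoverOn A β ∧ Refines β α), ordOn A β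

/-- `v^{σ(n)}` is defined at `x` (all steps up to `n` stay in the domains). -/
def DefinedUpTo (σ : ℕ → IFSMap X) (n : ℕ) (x : X) : Prop :=
  ∀ k < n, orbitIter σ x k ∈ (σ k).dom

/-- `v^{-σ(n)}(U) = v_1^{-1}∘⋯∘v_n^{-1}(U)` as a preimage under the partial map. -/
def preimageN (σ : ℕ → IFSMap X) (n : ℕ) (U : Set X) : Set X :=
  {x | DefinedUpTo σ n x ∧ orbitIter σ x n ∈ U}

/-- Join `α ∨ β` of two covers. -/
def coverJoin (α β : Set (Set X)) : Set (Set X) := Set.image2 (· ∩ ·) α β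

/-- `v^{-σ(n)}α`. -/
def coverPull (σ : ℕ → IFSMap X) (n : ℕ) (α : Set (Set X)) : Set (Set X) :=
  preimageN σ n '' α

/-- `coverUpTo σ α n = α_0^n(σ) = v^{-σ(0)}α ∨ ⋯ ∨ v^{-σ(n)}α`. -/
def coverUpTo (σ : ℕ → IFSMap X) (α : Set (Set X)) : ℕ → Set (Set X)
  | 0 => coverPull σ 0 α
  | n + 1 => coverJoin (coverUpTo σ α n) (coverPull σ (n + 1) α)

/-- `lim_{n→∞} 𝒟(α_0^{n-1}(σ))/n` (as an upper limit), the covers being considered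
relative to `Σ_σ`. -/
noncomputable def mdimCover (σ : ℕ → IFSMap X) (α : Set (Set X)) : ℝ≥0∞ :=
  limsup (fun n : ℕ =>
    ((coverD (SigmaSet σ) (coverUpTo σ α n) : ℝ≥0∞)) / ((n : ℝ≥0∞) + 1)) atTop

/-- Mean dimension of `(X,𝔙)` along `σ`. -/
noncomputable def mdimAlong (σ : ℕ → IFSMap X) : ℝ≥0∞ :=
  ⨆ (α : Set (Set X)) (_ : IsOpenCoverOn (Set.univ : Set X) α), mdimCover σ α

/-- Mean dimension of `(X,𝔙)`. -/
noncomputable def mdim (𝔙 : Set (IFSMap X)) : ℝ≥0∞ :=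
  ⨆ (σ : ℕ → IFSMap X) (_ : SeqIn 𝔙 σ), mdimAlong σ

/-! ### Orbit capacity and the small boundary property -/

/-- `cap(n,x,A) = sup_{σ∈Σ_x} (1/n) Σ_{i=0}^{n-1} 1_A(v^{σ(i)}(x))`. -/
noncomputable def capa (𝔙 : Set (IFSMap X)) (n : ℕ) (x : X) (A : Set X) : ℝ≥0∞ :=
  ⨆ (σ : ℕ → IFSMap X) (_ : SeqIn 𝔙 σ ∧ WellDef σ x),
    ({i : ℕ | i < n ∧ orbitIter σ x i ∈ A}.encard : ℝ≥0∞) / (n : ℝ≥0∞)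

/-- Orbit capacity `ocap(A) = lim_{n→∞} sup_{x∈X} cap(n,x,A)`. -/
noncomputable def ocap (𝔙 : Set (IFSMap X)) (A : Set X) : ℝ≥0∞ :=
  limsup (fun n : ℕ => ⨆ x : X, capa 𝔙 n x A) atTop

/-- The small boundary property. -/
def SmallBoundary (𝔙 : Set (IFSMap X)) : Prop :=
  ∀ x : X, ∀ U : Set X, IsOpen U → x ∈ U →
    ∃ V : Set X, IsOpen V ∧ x ∈ V ∧ V ⊆ U ∧ ocap 𝔙 (frontier V) = 0

/-! ### Gluing orbit property, transitivity, rigidity -/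

/-- `gapStart m t j = s_{j+1} = Σ_{i≤j-1} (m_i + t_i − 1)` (0-indexed). -/
def gapStart (m t : ℕ → ℕ) : ℕ → ℕ
  | 0 => 0
  | j + 1 => gapStart m t j + m j + t j - 1

/-- The Gluing Orbit Property: every orbit sequence (of length `N ∈ ℕ∞`, with
segment lengths `m j ∈ ℕ∞`, infinite only allowed for the last segment of a finite
sequence) can be `ε`-traced with gaps bounded by `M = M(ε)`. -/
def GluingOrbit (𝔙 : Set (IFSMap X)) : Prop :=
  ∀ ε : ℝ, 0 < ε → ∃ M : ℕ, 0 < M ∧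
    ∀ (N : ℕ∞) (x : ℕ → X) (σs : ℕ → ℕ → IFSMap X) (m : ℕ → ℕ∞),
      0 < N →
      (∀ j : ℕ, (j : ℕ∞) < N → SeqIn 𝔙 (σs j) ∧ WellDef (σs j) (x j)) →
      (∀ j : ℕ, (j : ℕ∞) < N → 1 ≤ m j) →
      (∀ j : ℕ, (j : ℕ∞) < N → m j = ⊤ → (j : ℕ∞) + 1 = N) →
      ∃ (t : ℕ → ℕ) (z : X) (φ : ℕ → IFSMap X),
        (∀ j : ℕ, 1 ≤ t j ∧ t j ≤ M) ∧ SeqIn 𝔙 φ ∧ WellDef φ z ∧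
        ∀ j : ℕ, (j : ℕ∞) < N → ∀ l : ℕ, (l : ℕ∞) < m j →
          dist (orbitIter φ z (gapStart (fun i => (m i).toNat) t j + l))
               (orbitIter (σs j) (x j) l) < ε

/-- `Tran(X,𝔙,σ)`: points `p` with `σ ∈ Σ_p` whose `σ`-orbit `{v^{σ(n)}(p) : n ≥ 1}`
is dense in `X`. -/
def Tran (σ : ℕ → IFSMap X) : Set X :=
  {p | WellDef σ p ∧ Dense (Set.range fun n : ℕ => orbitIter σ p (n + 1))}

/-- `σ` is uniformly rigid: `v^{σ(m_k)} → Id` uniformly on `Σ_σ` for some sequence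
`m_k` of natural numbers (`≥ 1`). -/
def UniformlyRigid (σ : ℕ → IFSMap X) : Prop :=
  ∃ m : ℕ → ℕ, (∀ k, 1 ≤ m k) ∧
    TendstoUniformlyOn (fun (k : ℕ) (x : X) => orbitIter σ x (m k)) id atTop (SigmaSet σ)

end IFS

namespace IFS

open Finset in
/-- A probabilistic choice: if every `y ∈ R` forbids at most three values at each coordinate,
some `ξ` hits fewer than `m` forbidden values for every `y ∈ R` simultaneously. -/
theorem exists_forall_card_hits_lt {ι K : Type*} [Fintype K] (R : Finset ι)
    {M m : ℕ} (hM : 0 < M) (J : ι → K → Finset (Fin M)) (hJ : ∀ y k, (J y k).card ≤ 3)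
    (h : R.card * 4 ^ Fintype.card K < M ^ m) :
    ∃ ξ : K → Fin M, ∀ y ∈ R, (univ.filter fun k => ξ k ∈ J y k).card < m := by
  classical
  by_contra! hcon
  have hprod (y : ι) :
      ∑ ξ : K → Fin M, M ^ (univ.filter fun k => ξ k ∈ J y k).card ≤
        (4 * M) ^ Fintype.card K := by
    calc ∑ ξ : K → Fin M, M ^ (univ.filter fun k => ξ k ∈ J y k).card
        = ∑ ξ : K → Fin M, ∏ k, (if ξ k ∈ J y k then M else 1) := by
          refine sum_congr rfl fun ξ _ => ?_
          rw [prod_ite]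
          simp
      _ = ∏ k, ∑ j : Fin M, (if j ∈ J y k then M else 1) := by
          rw [prod_univ_sum, Fintype.piFinset_univ]
      _ ≤ ∏ _k : K, (4 * M) := by
          refine prod_le_prod' fun k _ => ?_
          calc ∑ j : Fin M, (if j ∈ J y k then M else 1)
              ≤ ∑ j : Fin M, (1 + if j ∈ J y k then M else 0) := by
                refine sum_le_sum fun j _ => ?_
                split_ifs <;> omega
            _ = M + (J y k).card * M := by simp [sum_add_distrib]
            _ ≤ 4 * M := by nlinarith [hJ y k]
      _ = _ := by simp
  have hlow : M ^ Fintype.card K * M ^ m ≤ R.card * (4 * M) ^ Fintype.card K := by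
    calc M ^ Fintype.card K * M ^ m = ∑ _ξ : K → Fin M, M ^ m := by simp
      _ ≤ ∑ ξ : K → Fin M, ∑ y ∈ R, M ^ (univ.filter fun k => ξ k ∈ J y k).card := by
          refine sum_le_sum fun ξ _ => ?_
          obtain ⟨y, hy, hle⟩ := hcon ξ
          exact (Nat.pow_le_pow_right hM hle).trans
            (single_le_sum (f := fun y => M ^ (univ.filter fun k => ξ k ∈ J y k).card)
              (fun _ _ => Nat.zero_le _) hy)
      _ = ∑ y ∈ R, ∑ ξ : K → Fin M, M ^ (univ.filter fun k => ξ k ∈ J y k).card := sum_comm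
      _ ≤ R.card * (4 * M) ^ Fintype.card K := by
          simpa using sum_le_sum fun y (_ : y ∈ R) => hprod y
  have hpos : 0 < M ^ Fintype.card K := by positivity
  rw [mul_pow] at hlow
  nlinarith

/-- The integers `j` with `t - 2 < j < t + 1`, as elements of `Fin M`, number at most three. -/
theorem card_fin_near_le_three (M : ℕ) (t : ℝ) :
    (Finset.univ.filter fun j : Fin M => t - 2 < (j : ℝ) ∧ (j : ℝ) < t + 1).card ≤ 3 := by
  have hcard : (Finset.Icc (⌊t⌋ - 1) (⌊t⌋ + 1)).card = 3 := by
    rw [Int.card_Icc]; omega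
  rw [← hcard]
  refine Finset.card_le_card_of_injOn (fun j : Fin M => ((j : ℕ) : ℤ)) (fun j hj => ?_)
    (fun i _ j _ hij => ?_)
  · obtain ⟨h1, h2⟩ := (Finset.mem_filter.1 hj).2
    have h3 := Int.floor_le t
    have h4 := Int.lt_floor_add_one t
    have h5 : ((⌊t⌋ - 2 : ℤ) : ℝ) < ((j : ℕ) : ℤ) := by push_cast; linarith
    have h6 : (((j : ℕ) : ℤ) : ℝ) < ((⌊t⌋ + 2 : ℤ) : ℝ) := by push_cast; linarith
    rw [Int.cast_lt] at h5 h6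
    simp only [Finset.coe_Icc, Set.mem_Icc]
    omega
  · simpa [Fin.ext_iff] using hij

/-- An open set whose trace on the cube `[0,1]^K` is the open star of the vertex `S` in the order
triangulation of the cube. -/
def vertexStar {K : Type*} (S : Finset K) : Set (K → ℝ) :=
  {z | (∀ k ∈ S, 0 < z k) ∧ (∀ k ∉ S, z k < 1) ∧ ∀ k ∈ S, ∀ j ∉ S, z j < z k}

theorem isOpen_vertexStar {K : Type*} [Finite K] (S : Finset K) :
    IsOpen (vertexStar S) := by
  have : vertexStar S = (⋂ k ∈ S, {z : K → ℝ | 0 < z k}) ∩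
      ((⋂ k : K, ⋂ _ : k ∉ S, {z : K → ℝ | z k < 1}) ∩
        ⋂ k ∈ S, ⋂ j : K, ⋂ _ : j ∉ S, {z : K → ℝ | z j < z k}) := by
    ext z
    simp [vertexStar]
  rw [this]
  refine IsOpen.inter (isOpen_biInter_finset fun k _ => ?_) (IsOpen.inter
    (isOpen_iInter_of_finite fun k => isOpen_iInter_of_finite fun _ => ?_)
    (isOpen_biInter_finset fun k _ => isOpen_iInter_of_finite fun j =>
      isOpen_iInter_of_finite fun _ => ?_))
  · exact isOpen_lt continuous_const (continuous_apply k)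
  · exact isOpen_lt (continuous_apply k) continuous_const
  · exact isOpen_lt (continuous_apply j) (continuous_apply k)

/-- The vertices whose stars contain `z` form a chain, with one step at most for each coordinate
of `z` in `(0,1)`. -/
theorem encard_vertexStar_le {K : Type*} [Fintype K] (z : K → ℝ) {m : ℕ}
    (hm : (Finset.univ.filter fun k => 0 < z k ∧ z k < 1).card ≤ m) :
    {S : Finset K | z ∈ vertexStar S}.encard ≤ m + 1 := by
  classical
  set a := (Finset.univ.filter fun k => 1 ≤ z k) with ha
  set b := (Finset.univ.filter fun k => 0 < z k) with hb
  have hab : b.card ≤ a.card + m := by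
    have : b ⊆ a ∪ Finset.univ.filter fun k => 0 < z k ∧ z k < 1 := by
      intro k hk
      simp only [ha, hb, Finset.mem_union, Finset.mem_filter, Finset.mem_univ, true_and] at hk ⊢
      by_cases h : 1 ≤ z k
      · exact Or.inl h
      · exact Or.inr ⟨hk, not_le.1 h⟩
    exact (Finset.card_le_card this).trans
      ((Finset.card_union_le _ _).trans (Nat.add_le_add_left hm _))
  have hcard : (Finset.univ.filter fun S : Finset K => z ∈ vertexStar S).card ≤ m + 1 := by
    have hI : (Finset.Icc a.card b.card).card ≤ m + 1 := by
      rw [Nat.card_Icc]; omega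
    refine (Finset.card_le_card_of_injOn Finset.card (fun S hS => ?_)
      (fun S hS T hT hST => ?_)).trans hI
    · obtain ⟨h1, h2, -⟩ := (Finset.mem_filter.1 hS).2
      simp only [Finset.coe_Icc, Set.mem_Icc]
      constructor
      · refine Finset.card_le_card fun k hk => ?_
        by_contra hkS
        exact absurd (h2 k hkS) (not_lt.2 (Finset.mem_filter.1 hk).2)
      · exact Finset.card_le_card fun k hk => Finset.mem_filter.2 ⟨Finset.mem_univ _, h1 k hk⟩
    · obtain ⟨-, -, hS⟩ := (Finset.mem_filter.1 hS).2
      obtain ⟨-, -, hT⟩ := (Finset.mem_filter.1 hT).2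
      by_cases hsub : S ⊆ T
      · exact Finset.eq_of_subset_of_card_le hsub hST.ge
      · obtain ⟨k, hkS, hkT⟩ := Finset.not_subset.1 hsub
        refine (Finset.eq_of_subset_of_card_le (fun j hj => ?_) hST.le).symm
        by_contra hjS
        exact lt_asymm (hS k hkS j hjS) (hT j hj k hkT)
  rw [← Finset.coe_filter_univ, Set.encard_coe_eq_coe_finsetCard]
  exact_mod_cast hcard

variable {X : Type*} [MetricSpace X]

/-- A continuous map on `A` with at most `m` coordinates in `(0,1)` at each point, such that the
nonempty preimages of the vertex stars refine `α`, bounds `𝒟(α)` by `m`. -/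
theorem coverD_le_of_map_to_skeleton {A : Set X} {α : Set (Set X)} {K : Type*} [Fintype K]
    {F : X → K → ℝ} (hF : ContinuousOn F A) {m : ℕ}
    (hm : ∀ x ∈ A, (Finset.univ.filter fun k => 0 < F x k ∧ F x k < 1).card ≤ m)
    (href : ∀ S : Finset K, (A ∩ F ⁻¹' vertexStar S).Nonempty →
      ∃ W ∈ α, A ∩ F ⁻¹' vertexStar S ⊆ W) :
    coverD A α ≤ m := by
  classical
  set B : Finset K → Set X := fun S => A ∩ F ⁻¹' vertexStar S with hB
  set β : Set (Set X) := B '' {S | (B S).Nonempty} with hβ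
  have hcov : IsOpenCoverOn A β := by
    refine ⟨(Set.toFinite _).image B, ?_, fun x hx => ?_⟩
    · rintro _ ⟨S, -, rfl⟩
      obtain ⟨V, hV, hVe⟩ := continuousOn_iff'.1 hF _ (isOpen_vertexStar S)
      refine ⟨V, hV, ?_⟩
      rw [← hVe]
      ext x
      simp only [hB, Set.mem_inter_iff]
      tauto
    · have hx' : x ∈ B (Finset.univ.filter fun k => 0 < F x k) := by
        refine ⟨hx, ?_, ?_, ?_⟩
        · simp
        · intro k hk
          simp only [Finset.mem_filter, Finset.mem_univ, true_and, not_lt] at hk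
          linarith
        · intro k hk j hj
          simp only [Finset.mem_filter, Finset.mem_univ, true_and, not_lt] at hk hj
          linarith
      exact ⟨_, ⟨_, ⟨x, hx'⟩, rfl⟩, hx'⟩
  have hrefines : Refines β α := by
    rintro _ ⟨S, hS, rfl⟩
    exact href S hS
  refine (iInf₂_le β ⟨hcov, hrefines⟩).trans ?_
  unfold ordOn
  refine tsub_le_iff_right.2 (iSup₂_le fun x hx => ?_)
  calc {U ∈ β | x ∈ U}.encard ≤ (B '' {S | F x ∈ vertexStar S}).encard := by
        refine Set.encard_le_encard ?_
        rintro _ ⟨⟨S, -, rfl⟩, hxS⟩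
        exact ⟨S, hxS.2, rfl⟩
    _ ≤ {S | F x ∈ vertexStar S}.encard := Set.encard_image_le _ _
    _ ≤ m + 1 := encard_vertexStar_le _ (hm x hx)

theorem exists_mem_coverUpTo_superset {σ : ℕ → IFSMap X} {α : Set (Set X)} {B : Set X}
    (hB : B ⊆ SigmaSet σ) (n : ℕ)
    (h : ∀ i ≤ n, ∃ V ∈ α, ∀ x ∈ B, orbitIter σ x i ∈ V) :
    ∃ W ∈ coverUpTo σ α n, B ⊆ W := by
  induction n with
  | zero =>
    obtain ⟨V, hV, hBV⟩ := h 0 le_rfl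
    exact ⟨_, ⟨V, hV, rfl⟩, fun x hx => ⟨fun k _ => hB hx k, hBV x hx⟩⟩
  | succ n ih =>
    obtain ⟨W, hW, hBW⟩ := ih fun i hi => h i (hi.trans n.le_succ)
    obtain ⟨V, hV, hBV⟩ := h (n + 1) le_rfl
    exact ⟨_, ⟨W, hW, _, ⟨V, hV, rfl⟩, rfl⟩,
      fun x hx => ⟨hBW hx, fun k _ => hB hx k, hBV x hx⟩⟩

theorem continuousOn_orbitIter (σ : ℕ → IFSMap X) (n : ℕ) :
    ContinuousOn (fun x => orbitIter σ x n) (SigmaSet σ) := by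
  induction n with
  | zero => exact continuousOn_id
  | succ n ih => exact (σ n).contOn.comp ih fun x hx => hx n

/-- A finite spanning set at a scale small compared with the Lebesgue number of `α`
bounds `𝒟(α_0^n(σ))`. -/
theorem exists_coverD_le_of_spanning [CompactSpace X] {𝔙 : Set (IFSMap X)}
    {σ : ℕ → IFSMap X} (hσ : SeqIn 𝔙 σ) {α : Set (Set X)} (hα : IsOpenCoverOn Set.univ α) :
    ∃ (l : ℕ) (r : ℝ), 0 < r ∧ ∀ (n M m : ℕ) (ε : ℝ) (R : Finset (X × (ℕ → IFSMap X))),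
      0 < M → M * ε ≤ r → IsSpanning 𝔙 (n + 1) ε (R : Set (X × (ℕ → IFSMap X))) →
      R.card * 4 ^ (l * (n + 1)) < M ^ m →
      coverD (SigmaSet σ) (coverUpTo σ α n) ≤ m := by
  classical
  obtain ⟨-, hopen, hcov⟩ := hα
  have hopen' : ∀ U ∈ α, IsOpen U := by
    intro U hU
    obtain ⟨V, hV, hUV⟩ := hopen U hU
    simp only [Set.inter_univ] at hUV
    exact hUV ▸ hV
  obtain ⟨δ, hδ, hleb⟩ := lebesgue_number_lemma_of_metric_sUnion isCompact_univ hopen' hcov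
  obtain ⟨r, hr, hrδ⟩ : ∃ r : ℝ, 0 < r ∧ 2 * r = δ := ⟨δ / 2, by positivity, by ring⟩
  obtain ⟨P₀, -, hP₀, hPcov⟩ := (isCompact_univ (X := X)).finite_cover_balls hr
  obtain ⟨P, rfl⟩ := hP₀.exists_finset_coe
  refine ⟨P.card, r, hr, fun n M m ε R hM hMε hR hcount => ?_⟩
  set τ : X → X → ℝ := fun p y => M * (dist y p / r - 1) with hτ
  have hMpos : (0 : ℝ) < M := by exact_mod_cast hM
  obtain ⟨ξ, hξ⟩ := exists_forall_card_hits_lt (K := P × Fin (n + 1)) R hM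
    (fun q k => Finset.univ.filter fun j : Fin M =>
      τ k.1 (orbitIter q.2 q.1 k.2) - 2 < (j : ℝ) ∧
        (j : ℝ) < τ k.1 (orbitIter q.2 q.1 k.2) + 1)
    (fun q k => card_fin_near_le_three M _) (by simpa using hcount)
  set F : X → P × Fin (n + 1) → ℝ :=
    fun x k => τ k.1 (orbitIter σ x k.2) - (ξ k : ℕ) with hF
  refine coverD_le_of_map_to_skeleton (F := F) ?_ ?_ ?_
  · refine continuousOn_pi.2 fun k => ?_
    have := continuousOn_orbitIter σ k.2
    simp only [hF, hτ]
    fun_prop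
  · intro x hx
    obtain ⟨q, hqR, hq⟩ := hR.2 x σ hσ hx
    refine (Finset.card_le_card fun k hk => ?_).trans (hξ q hqR).le
    simp only [hF, Finset.mem_filter, Finset.mem_univ, true_and] at hk ⊢
    have hd := (abs_dist_sub_le (orbitIter σ x k.2) (orbitIter q.2 q.1 k.2) (k.1 : X)).trans_lt
      (hq k.2 k.2.2)
    have hdiff : |τ k.1 (orbitIter σ x k.2) - τ k.1 (orbitIter q.2 q.1 k.2)| < 1 := by
      have : τ k.1 (orbitIter σ x k.2) - τ k.1 (orbitIter q.2 q.1 k.2) =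
          M / r * (dist (orbitIter σ x k.2) k.1 - dist (orbitIter q.2 q.1 k.2) k.1) := by
        simp only [hτ]; ring
      rw [this, abs_mul, abs_of_pos (by positivity)]
      calc M / r * |dist (orbitIter σ x k.2) k.1 - dist (orbitIter q.2 q.1 k.2) k.1|
          < M / r * ε := by gcongr
        _ = M * ε / r := by ring
        _ ≤ 1 := (div_le_one hr).2 hMε
    obtain ⟨h1, h2⟩ := abs_lt.1 hdiff
    constructor <;> linarith [hk.1, hk.2]
  · rintro S ⟨x₀, hx₀, hx₀S, -⟩
    refine exists_mem_coverUpTo_superset Set.inter_subset_left n fun i hi => ?_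
    obtain ⟨p, hp, hx₀p⟩ := Set.mem_iUnion₂.1 (hPcov (Set.mem_univ (orbitIter σ x₀ i)))
    set k : P × Fin (n + 1) := (⟨p, hp⟩, ⟨i, Nat.lt_succ_of_le hi⟩) with hk
    have hkS : k ∉ S := by
      intro hkS
      have := hx₀S k hkS
      have hneg : τ p (orbitIter σ x₀ i) ≤ 0 := by
        refine mul_nonpos_of_nonneg_of_nonpos hMpos.le ?_
        rw [sub_nonpos, div_le_one hr]
        exact (Metric.mem_ball.1 hx₀p).le
      have : (0 : ℝ) ≤ (ξ k : ℕ) := Nat.cast_nonneg _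
      simp only [hF, hk] at *
      linarith
    obtain ⟨V, hV, hballV⟩ := hleb p (Set.mem_univ p)
    refine ⟨V, hV, fun x hx => hballV ?_⟩
    have hx1 := hx.2.2.1 k hkS
    have hξM : ((ξ k : ℕ) : ℝ) + 1 ≤ M := by exact_mod_cast (ξ k).2
    have hlt : M * (dist (orbitIter σ x i) p / r - 1) < M * 1 := by
      simp only [hF, hk, hτ] at *
      linarith
    have := lt_of_mul_lt_mul_left hlt hMpos.le
    rw [Metric.mem_ball, ← hrδ, ← div_lt_iff₀ hr]
    linarith

theorem IsIFS.exists_wellDef {𝔙 : Set (IFSMap X)} (h : IsIFS 𝔙) :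
    ∃ (x : X) (σ : ℕ → IFSMap X), SeqIn 𝔙 σ ∧ WellDef σ x := by
  obtain ⟨O, ⟨x₀, hx₀⟩, hsub⟩ := h
  set Y := ⋃ v ∈ 𝔙, v.toFun '' (v.dom ∩ O) with hY
  have hstep : ∀ y : Y, ∃ v ∈ 𝔙, (y : X) ∈ v.dom ∧ v.toFun y ∈ Y := by
    rintro ⟨y, hy⟩
    obtain ⟨v, hv, hyv⟩ := Set.mem_iUnion₂.1 (hsub hy)
    exact ⟨v, hv, hyv.1, Set.mem_iUnion₂.2 ⟨v, hv, y, hyv, rfl⟩⟩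
  choose v hv hdom hmem using hstep
  set orb : ℕ → Y := fun n => (fun y : Y => (⟨(v y).toFun y, hmem y⟩ : Y))^[n] ⟨x₀, hx₀⟩
    with horb
  have hiter : ∀ n, orbitIter (fun n => v (orb n)) x₀ n = orb n := by
    intro n
    induction n with
    | zero => rfl
    | succ n ih =>
      rw [orbitIter, ih]
      simp only [horb, Function.iterate_succ_apply']
  refine ⟨x₀, fun n => v (orb n), fun n => hv _, fun n => ?_⟩
  rw [hiter]
  exact hdom _

theorem one_le_spanNum {𝔙 : Set (IFSMap X)} (h : IsIFS 𝔙) (n : ℕ) (ε : ℝ) :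
    1 ≤ spanNum 𝔙 n ε := by
  obtain ⟨x, σ, hσ, hx⟩ := h.exists_wellDef
  refine le_iInf₂ fun R hR => ?_
  obtain ⟨p, hp, -⟩ := hR.2 x σ hσ hx
  have : (1 : ℕ∞) ≤ R.encard := Set.one_le_encard_iff_nonempty.2 ⟨p, hp⟩
  exact_mod_cast this

theorem entropyRate_nonneg {𝔙 : Set (IFSMap X)} (h : IsIFS 𝔙) (ε : ℝ) :
    0 ≤ entropyRate 𝔙 ε := by
  refine le_limsup_of_frequently_le (Frequently.of_forall fun n => ?_)
  refine mul_nonneg (EReal.coe_nonneg.2 (by positivity)) ?_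
  rw [← ENNReal.log_one]
  exact ENNReal.log_monotone (one_le_spanNum h n ε)

theorem lmdim_nonneg {𝔙 : Set (IFSMap X)} (h : IsIFS 𝔙) : 0 ≤ lmdim 𝔙 := by
  refine le_liminf_of_le (h := Eventually.of_forall fun ε => ?_)
  exact mul_nonneg (EReal.coe_nonneg.2 (by positivity)) (entropyRate_nonneg h ε)

theorem exists_spanning_of_log_spanNum_lt {𝔙 : Set (IFSMap X)} {n : ℕ} {ε c : ℝ}
    (hn : 0 < n) (h : (((n : ℝ)⁻¹ : ℝ) : EReal) * ENNReal.log (spanNum 𝔙 n ε) < c) :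
    ∃ R : Finset (X × (ℕ → IFSMap X)),
      IsSpanning 𝔙 n ε (R : Set (X × (ℕ → IFSMap X))) ∧ (R.card : ℝ) < Real.exp (n * c) := by
  have hn' : (0 : ℝ) < n := by exact_mod_cast hn
  have hlog : ENNReal.log (spanNum 𝔙 n ε) < ((n * c : ℝ) : EReal) := by
    by_contra! hcon
    have := mul_le_mul_of_nonneg_left hcon
      (EReal.coe_nonneg.2 (inv_nonneg.2 hn'.le) : (0 : EReal) ≤ (((n : ℝ)⁻¹ : ℝ) : EReal))
    rw [← EReal.coe_mul, inv_mul_cancel_left₀ hn'.ne'] at this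
    exact absurd h (not_lt.2 this)
  have hlt : spanNum 𝔙 n ε < ENNReal.ofReal (Real.exp (n * c)) := by
    rw [← ENNReal.log_lt_log_iff, ENNReal.log_ofReal_of_pos (Real.exp_pos _), Real.log_exp]
    exact hlog
  obtain ⟨R, hR, hRlt⟩ : ∃ R, ∃ _ : IsSpanning 𝔙 n ε R,
      (R.encard : ℝ≥0∞) < ENNReal.ofReal (Real.exp (n * c)) := by
    simpa only [spanNum, iInf_lt_iff] using hlt
  have hfin : R.Finite := by
    rw [← Set.encard_ne_top_iff]
    intro htop
    rw [htop] at hRlt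
    simp at hRlt
  obtain ⟨R, rfl⟩ := hfin.exists_finset_coe
  refine ⟨R, hR, ?_⟩
  rw [Set.encard_coe_eq_coe_finsetCard] at hRlt
  have : ENNReal.ofReal (R.card : ℝ) < ENNReal.ofReal (Real.exp (n * c)) := by
    simpa using hRlt
  exact (ENNReal.ofReal_lt_ofReal_iff (Real.exp_pos _)).1 this

theorem mdimCover_le_of_lmdim_lt [CompactSpace X] {𝔙 : Set (IFSMap X)} (h : IsIFS 𝔙)
    {σ : ℕ → IFSMap X} (hσ : SeqIn 𝔙 σ) {α : Set (Set X)} (hα : IsOpenCoverOn Set.univ α)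
    {c : ℝ} (hc : lmdim 𝔙 < c) : mdimCover σ α ≤ ENNReal.ofReal c := by
  obtain ⟨a, ha, hac⟩ := EReal.lt_iff_exists_real_btwn.1 hc
  rw [EReal.coe_lt_coe_iff] at hac
  have ha0 : 0 < a := by exact_mod_cast (lmdim_nonneg h).trans_lt ha
  obtain ⟨b, hab, hbc⟩ := exists_between hac
  have hb0 : 0 < b := ha0.trans hab
  obtain ⟨l, r, hr, hkey⟩ := exists_coverD_le_of_spanning hσ hα
  have hfreq := frequently_lt_of_liminf_lt (by isBoundedDefault) ha
  have hlogtop : Tendsto (fun ε : ℝ => -Real.log ε) (𝓝[>] 0) atTop :=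
    tendsto_neg_atBot_atTop.comp Real.tendsto_log_nhdsGT_zero
  have hpos : ∀ᶠ ε : ℝ in 𝓝[>] 0, 0 < ε := eventually_mem_nhdsWithin
  have hsmall : ∀ᶠ ε : ℝ in 𝓝[>] 0, ε < r / 2 :=
    eventually_nhdsWithin_of_eventually_nhds (eventually_lt_nhds (by positivity))
  have hT : ∀ᶠ ε : ℝ in 𝓝[>] 0,
      max 1 ((l * Real.log 4 - b * Real.log (r / 2)) / (b - a)) ≤ -Real.log ε :=
    hlogtop.eventually_ge_atTop _
  obtain ⟨ε, hεa, hε, hεr, hεT⟩ := (hfreq.and_eventually (hpos.and (hsmall.and hT))).exists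
  obtain ⟨hT1, hT2⟩ := max_le_iff.1 hεT
  set T := -Real.log ε with hTdef
  have habs : |Real.log ε| = T := by
    rw [abs_of_neg (by linarith)]
  have hT0 : 0 < T := by linarith
  rw [div_le_iff₀ (by linarith)] at hT2
  have hrate : entropyRate 𝔙 ε < ((a * T : ℝ) : EReal) := by
    by_contra! hcon
    have := mul_le_mul_of_nonneg_left hcon
      (EReal.coe_nonneg.2 (inv_nonneg.2 hT0.le) : (0 : EReal) ≤ ((T⁻¹ : ℝ) : EReal))
    rw [← EReal.coe_mul, show T⁻¹ * (a * T) = a by field_simp] at this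
    rw [habs] at hεa
    exact absurd hεa (not_lt.2 this)
  have hev := (tendsto_add_atTop_nat 1).eventually
    (eventually_lt_of_limsup_lt hrate (by isBoundedDefault))
  set M := ⌊r / ε⌋₊ with hM
  have hone : 2 < r / ε := by rw [lt_div_iff₀ hε]; linarith
  have hMge : r / 2 / ε ≤ M := by
    have := Nat.lt_floor_add_one (r / ε)
    rw [div_right_comm]
    linarith
  have hMpos : 0 < M := Nat.floor_pos.2 (by linarith)
  have hMε : M * ε ≤ r := (le_div_iff₀ hε).1 (Nat.floor_le (by positivity))
  have hMpos' : (0 : ℝ) < M := by exact_mod_cast hMpos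
  have hlogM : a * T + l * Real.log 4 ≤ b * Real.log M := by
    have : T + Real.log (r / 2) ≤ Real.log M := by
      rw [hTdef, neg_add_eq_sub, ← Real.log_div (by positivity) hε.ne']
      exact Real.log_le_log (by positivity) hMge
    nlinarith [mul_le_mul_of_nonneg_left this hb0.le]
  have hlarge : ∀ᶠ n : ℕ in atTop, 1 / (c - b) ≤ (n : ℝ) :=
    tendsto_natCast_atTop_atTop.eventually_ge_atTop _
  refine limsup_le_of_le (h := ?_)
  filter_upwards [hev, hlarge] with n hn hnl
  obtain ⟨R, hR, hRcard⟩ := exists_spanning_of_log_spanNum_lt n.succ_pos hn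
  set m := ⌈((n : ℝ) + 1) * b⌉₊ with hm
  have hcount : R.card * 4 ^ (l * (n + 1)) < M ^ m := by
    have : (R.card : ℝ) * 4 ^ (l * (n + 1)) < (M : ℝ) ^ m := by
      calc (R.card : ℝ) * 4 ^ (l * (n + 1))
          < Real.exp ((n + 1 : ℕ) * (a * T)) * 4 ^ (l * (n + 1)) := by gcongr
        _ = Real.exp ((n + 1) * (a * T + l * Real.log 4)) := by
            rw [← Real.exp_log (show (0 : ℝ) < 4 ^ (l * (n + 1)) by positivity), ← Real.exp_add,
              Real.log_pow]
            push_cast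
            ring_nf
        _ ≤ Real.exp (m * Real.log M) := by
            refine Real.exp_le_exp.2 ?_
            have h1 : ((n : ℝ) + 1) * b ≤ m := Nat.le_ceil _
            have h2 : 0 ≤ Real.log M := Real.log_natCast_nonneg M
            calc ((n : ℝ) + 1) * (a * T + l * Real.log 4)
                ≤ (n + 1) * (b * Real.log M) := by gcongr
              _ = (n + 1) * b * Real.log M := by ring
              _ ≤ m * Real.log M := by gcongr
        _ = (M : ℝ) ^ m := by
            rw [← Real.log_pow, Real.exp_log (by positivity)]
    exact_mod_cast this
  have hD := hkey n M m ε R hMpos hMε hR hcount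
  have hmc : (m : ℝ) ≤ c * (n + 1) := by
    have h1 : (m : ℝ) < (n + 1) * b + 1 := Nat.ceil_lt_add_one (by positivity)
    rw [div_le_iff₀ (by linarith)] at hnl
    nlinarith
  have hD' : ((coverD (SigmaSet σ) (coverUpTo σ α n) : ℕ∞) : ℝ≥0∞) ≤ (m : ℝ≥0∞) := by
    exact_mod_cast hD
  refine ENNReal.div_le_of_le_mul (hD'.trans ?_)
  have hc0 : 0 ≤ c := by linarith
  calc (m : ℝ≥0∞) = ENNReal.ofReal m := (ENNReal.ofReal_natCast m).symm
    _ ≤ ENNReal.ofReal (c * (n + 1)) := ENNReal.ofReal_le_ofReal hmc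
    _ = ENNReal.ofReal c * (n + 1) := by
        rw [ENNReal.ofReal_mul hc0, ENNReal.ofReal_add (by positivity) (by positivity)]
        simp

end IFS

open IFS in
/-- **Theorem A.** For an iterated function system `(X,𝔙)`,
`mdim(X,𝔙) ≤ lmdim(X,𝔙) ≤ umdim(X,𝔙)`. -/
theorem mdim_le_lmdim_le_umdim {X : Type*} [MetricSpace X] [CompactSpace X]
    (𝔙 : Set (IFSMap X)) (hIFS : IsIFS 𝔙) :
    (mdim 𝔙 : EReal) ≤ lmdim 𝔙 ∧ lmdim 𝔙 ≤ umdim 𝔙 := by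
  refine ⟨?_, liminf_le_limsup⟩
  have hle : mdim 𝔙 ≤ (lmdim 𝔙).toENNReal := by
    refine iSup₂_le fun σ hσ => iSup₂_le fun α hα => ?_
    refine le_of_forall_gt_imp_ge_of_dense fun c hc => ?_
    rcases eq_or_ne c ⊤ with rfl | hctop
    · exact le_top
    have hc' : lmdim 𝔙 < (c.toReal : EReal) := by
      have := EReal.coe_ennreal_lt_coe_ennreal_iff.2 hc
      rw [EReal.coe_toENNReal (lmdim_nonneg hIFS)] at this
      rwa [EReal.coe_ennreal_toReal hctop]
    simpa [ENNReal.ofReal_toReal hctop] using mdimCover_le_of_lmdim_lt hIFS hσ hα hc'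
  calc (mdim 𝔙 : EReal) ≤ ((lmdim 𝔙).toENNReal : EReal) :=
        EReal.coe_ennreal_le_coe_ennreal_iff.2 hle
    _ = lmdim 𝔙 := EReal.coe_toENNReal (lmdim_nonneg hIFS)
end

section
/- Let (X,𝔙) be an iterated function system with the Gluing Orbit Property such that Tran(X,𝔙,σ) ≠ ∅ for some σ ∈ Σ that is not uniformly rigid. Then the topological entropy satisfies h(X,𝔙) > 0. -/
open Filter Topology Set
open scoped ENat ENNReal

namespace IFS

variable {X : Type*} [MetricSpace X]

/-- If `σ` is not uniformly rigid, then its iterates stay uniformly away from the identity. -/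
lemma exists_le_dist_of_not_uniformlyRigid {σ : ℕ → IFSMap X} (h : ¬ UniformlyRigid σ) :
    ∃ γ : ℝ, 0 < γ ∧ ∀ n : ℕ, 1 ≤ n → ∃ x, WellDef σ x ∧ γ ≤ dist (orbitIter σ x n) x := by
  by_contra! hc
  choose m hm hd using fun k : ℕ => hc (1 / ((k : ℝ) + 1)) (by positivity)
  refine h ⟨m, hm, Metric.tendstoUniformlyOn_iff.2 fun ε hε => ?_⟩
  obtain ⟨K, hK⟩ := exists_nat_one_div_lt hε
  filter_upwards [eventually_ge_atTop K] with k hk x hx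
  rw [dist_comm]
  exact (hd k x hx).trans_le ((Nat.one_div_le_one_div hk).trans hK.le)

/-- Gluing orbit segments along a non-rigid sequence produces a single orbit that is not
almost periodic with any period. -/
lemma GluingOrbit.exists_orbit_aperiodic {𝔙 : Set (IFSMap X)} (hG : GluingOrbit 𝔙)
    {σ : ℕ → IFSMap X} (hσ : SeqIn 𝔙 σ) {γ : ℝ} (hγ : 0 < γ)
    (h : ∀ n : ℕ, 1 ≤ n → ∃ x, WellDef σ x ∧ γ ≤ dist (orbitIter σ x n) x) :
    ∃ (y : X) (φ : ℕ → IFSMap X), SeqIn 𝔙 φ ∧ WellDef φ y ∧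
      ∀ n : ℕ, 1 ≤ n → ∃ k, 3 * γ / 4 ≤ dist (orbitIter φ y (k + n)) (orbitIter φ y k) := by
  choose x hx hd using fun j : ℕ => h (j + 1) (Nat.le_add_left 1 j)
  obtain ⟨M, -, hM⟩ := hG (γ / 8) (by positivity)
  obtain ⟨t, y, φ, -, hφ, hy, htr⟩ := hM ⊤ x (fun _ => σ) (fun j => ((j + 2 : ℕ) : ℕ∞))
    (by simp) (fun j _ => ⟨hσ, hx j⟩) (fun j _ => by exact_mod_cast Nat.le_add_left 1 (j + 1))
    (fun j _ hj => absurd hj (ENat.natCast_ne_top _))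
  refine ⟨y, φ, hφ, hy, fun n hn => ?_⟩
  obtain ⟨j, rfl⟩ := Nat.exists_eq_add_of_le' hn
  generalize gapStart _ t = s at htr
  have h0 : dist (orbitIter φ y (s j)) (x j) < γ / 8 :=
    htr j (ENat.natCast_lt_top j) 0 (by exact_mod_cast Nat.succ_pos (j + 1))
  have h1 := htr j (ENat.natCast_lt_top j) (j + 1) (by exact_mod_cast Nat.lt_succ_self (j + 1))
  rw [dist_comm] at h1
  refine ⟨s j, ?_⟩
  linarith [hd j, dist_triangle4 (orbitIter σ (x j) (j + 1)) (orbitIter φ y (s j + (j + 1)))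
    (orbitIter φ y (s j)) (x j)]

lemma gapStart_succ {m t : ℕ → ℕ} (ht : ∀ j, 1 ≤ t j) (j : ℕ) :
    gapStart m t (j + 1) + 1 = gapStart m t j + m j + t j := by
  have := ht j
  simp only [gapStart]
  omega

lemma gapStart_le {m t : ℕ → ℕ} {L M : ℕ} (hm : ∀ j, m j ≤ L) (ht : ∀ j, t j ≤ M) (j : ℕ) :
    gapStart m t j ≤ j * (L + M) := by
  induction j with
  | zero => simp [gapStart]
  | succ j ih =>
    have := hm j
    have := ht j
    rw [add_mul, one_mul]
    simp only [gapStart]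
    omega

/-- The length of the orbit segment that encodes a binary symbol. -/
def segLength (L M : ℕ) (b : Bool) : ℕ := if b then L + M else L

/-- Different binary words have starting times that differ, by less than `2 * M`, at some
common segment. -/
lemma exists_gapStart_ne {L M N : ℕ} {w w' : ℕ → Bool} {t t' : ℕ → ℕ}
    (ht : ∀ j, 1 ≤ t j ∧ t j ≤ M) (ht' : ∀ j, 1 ≤ t' j ∧ t' j ≤ M)
    (hw : ∃ j < N, w j ≠ w' j) :
    ∃ i ≤ N, gapStart (fun j => segLength L M (w j)) t i ≠
        gapStart (fun j => segLength L M (w' j)) t' i ∧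
      gapStart (fun j => segLength L M (w j)) t i <
        gapStart (fun j => segLength L M (w' j)) t' i + 2 * M ∧
      gapStart (fun j => segLength L M (w' j)) t' i <
        gapStart (fun j => segLength L M (w j)) t i + 2 * M := by
  classical
  have succ := gapStart_succ (m := fun j => segLength L M (w j)) fun j => (ht j).1
  have succ' := gapStart_succ (m := fun j => segLength L M (w' j)) fun j => (ht' j).1
  set s := gapStart (fun j => segLength L M (w j)) t with hs
  set s' := gapStart (fun j => segLength L M (w' j)) t' with hs'
  have hex : ∃ i, i ≤ N ∧ s i ≠ s' i := by
    by_contra! hc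
    obtain ⟨j, hj, hne⟩ := hw
    have e0 := hc j hj.le
    have e1 := hc (j + 1) hj
    have a := succ j
    have a' := succ' j
    have b := ht j
    have b' := ht' j
    cases h : w j <;> cases h' : w' j <;> simp only [h, h', segLength] at a a' hne <;>
      simp at a a' hne <;> omega
  obtain ⟨hN, hne⟩ := Nat.find_spec hex
  refine ⟨Nat.find hex, hN, hne, ?_⟩
  cases hi : Nat.find hex with
  | zero => rw [hi] at hne; simp [hs, hs', gapStart] at hne
  | succ i =>
    have e : s i = s' i := by
      by_contra hc
      exact Nat.find_min hex (m := i) (by omega) ⟨by omega, hc⟩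
    have a := succ i
    have a' := succ' i
    have b := ht i
    have b' := ht' i
    cases h : w i <;> cases h' : w' i <;> simp only [h, h', segLength] at a a' <;>
      simp at a a' <;> omega

/-- Two orbits tracing copies of an aperiodic orbit segment from different starting times are
separated. -/
lemma exists_le_dist_of_trace_lt {φ ψ ψ' : ℕ → IFSMap X} {y z z' : X} {δ ε : ℝ}
    {L s s' ℓ ℓ' : ℕ} (hs : s < s') (hℓ : L ≤ ℓ) (hℓ' : L ≤ ℓ')
    (hsep : ∃ k, k + (s' - s) < L ∧
      δ ≤ dist (orbitIter φ y (k + (s' - s))) (orbitIter φ y k))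
    (hz : ∀ l < ℓ, dist (orbitIter ψ z (s + l)) (orbitIter φ y l) < ε)
    (hz' : ∀ l < ℓ', dist (orbitIter ψ' z' (s' + l)) (orbitIter φ y l) < ε) :
    ∃ i < s' + L, δ - 2 * ε ≤ dist (orbitIter ψ z i) (orbitIter ψ' z' i) := by
  obtain ⟨k, hk, hd⟩ := hsep
  refine ⟨s' + k, by omega, ?_⟩
  have h1 := hz (k + (s' - s)) (by omega)
  have h2 := hz' k (by omega)
  rw [show s + (k + (s' - s)) = s' + k by omega] at h1
  rw [dist_comm] at h1
  have := dist_triangle4 (orbitIter φ y (k + (s' - s))) (orbitIter ψ z (s' + k))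
    (orbitIter ψ' z' (s' + k)) (orbitIter φ y k)
  linarith

/-- A family of orbits that are pairwise `2ε`-separated up to time `n` bounds `r(n,ε)` from
below. -/
lemma card_le_spanNum {𝔙 : Set (IFSMap X)} {ι : Type*} [Fintype ι] {n : ℕ} {ε : ℝ}
    (z : ι → X) (ψ : ι → ℕ → IFSMap X) (hψ : ∀ a, SeqIn 𝔙 (ψ a) ∧ WellDef (ψ a) (z a))
    (hsep : ∀ a b, a ≠ b →
      ∃ i < n, 2 * ε ≤ dist (orbitIter (ψ a) (z a) i) (orbitIter (ψ b) (z b) i)) :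
    (Fintype.card ι : ℝ≥0∞) ≤ spanNum 𝔙 n ε := by
  refine le_iInf₂ fun R hR => ?_
  choose p hp hd using fun a => hR.2 (z a) (ψ a) (hψ a).1 (hψ a).2
  have hinj : Function.Injective fun a => (⟨p a, hp a⟩ : R) := by
    intro a b hab
    by_contra hne
    obtain ⟨i, hi, hle⟩ := hsep a b hne
    have h1 := hd a i hi
    have h2 := hd b i hi
    rw [← show p a = p b from congrArg Subtype.val hab, dist_comm] at h2
    exact absurd (dist_triangle _ _ _) (not_le.2 ((add_lt_add h1 h2).trans_le (by linarith)))
  have := ENat.card_le_card_of_injective hinj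
  rw [ENat.card_eq_coe_fintype_card] at this
  exact_mod_cast ENat.toENNReal_le.2 this

/-- Exponential growth of `r(n,ε)` along an arithmetic progression gives a positive rate. -/
lemma entropyRate_pos_of_two_pow_le {𝔙 : Set (IFSMap X)} {ε : ℝ} {T : ℕ} (hT : 0 < T)
    (h : ∀ N : ℕ, (2 : ℝ≥0∞) ^ N ≤ spanNum 𝔙 ((N + 1) * T) ε) :
    0 < entropyRate 𝔙 ε := by
  have hc : (0 : ℝ) < Real.log 2 / (2 * T) := by
    have := Real.log_pos one_lt_two
    positivity
  refine (EReal.coe_pos.2 hc).trans_le (le_limsup_of_frequently_le ?_)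
  refine frequently_atTop.2 fun a => ⟨(a + 1 + 1) * T, by nlinarith, ?_⟩
  have hlog : (((a + 1 : ℕ) * Real.log 2 : ℝ) : EReal) ≤
      ENNReal.log (spanNum 𝔙 ((a + 1 + 1) * T) ε) := by
    refine le_trans (le_of_eq ?_) (ENNReal.log_monotone (h (a + 1)))
    rw [← ENNReal.ofReal_ofNat 2, ← ENNReal.ofReal_pow two_pos.le,
      ENNReal.log_ofReal_of_pos (by positivity), Real.log_pow]
  refine le_trans ?_ (mul_le_mul_of_nonneg_left hlog (EReal.coe_nonneg.2 (by positivity)))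
  rw [← EReal.coe_mul, EReal.coe_le_coe_iff, ← div_eq_inv_mul]
  have hT' : (0 : ℝ) < T := by exact_mod_cast hT
  have hl := Real.log_pos one_lt_two
  push_cast
  rw [div_le_div_iff₀ (by positivity) (by positivity)]
  have : 0 ≤ Real.log 2 * T * a := by positivity
  nlinarith

end IFS

open IFS in
/-- **Theorem C.** An iterated function system with the Gluing Orbit Property, such
that `Tran(X,𝔙,σ) ≠ ∅` for some `σ ∈ Σ` that is not uniformly rigid, has positive
topological entropy. -/
theorem entropy_pos_of_gluingOrbit {X : Type*} [MetricSpace X] [CompactSpace X]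
    (𝔙 : Set (IFSMap X)) (hIFS : IsIFS 𝔙) (hGOP : GluingOrbit 𝔙)
    (σ : ℕ → IFSMap X) (hσ : SeqIn 𝔙 σ) (hTran : (Tran σ).Nonempty)
    (hRigid : ¬ UniformlyRigid σ) :
    0 < entropy 𝔙 := by
  obtain ⟨γ, hγ, hfar⟩ := exists_le_dist_of_not_uniformlyRigid hRigid
  obtain ⟨y, φ, hφ, hy, hap⟩ := hGOP.exists_orbit_aperiodic hσ hγ hfar
  obtain ⟨M, hM0, hM⟩ := hGOP (γ / 8) (by positivity)
  choose! k hk using hap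
  obtain ⟨L, hL⟩ : ∃ L : ℕ, ∀ n < 2 * M, k n + n < L := by
    refine ⟨(Finset.range (2 * M)).sup (fun n => k n + n) + 1, fun n hn => ?_⟩
    exact Nat.lt_succ_of_le
      (Finset.le_sup (f := fun n => k n + n) (Finset.mem_range.2 hn))
  have hL0 : 0 < L := Nat.zero_lt_of_lt (hL 0 (by omega))
  have hseg (b : Bool) : L ≤ segLength L M b ∧ segLength L M b ≤ L + M := by
    cases b <;> simp [segLength]
  choose t z ψ ht hψ hz htr using fun w : ℕ → Bool =>
    hM ⊤ (fun _ => y) (fun _ => φ) (fun j => (segLength L M (w j) : ℕ∞)) (by simp)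
      (fun _ _ => ⟨hφ, hy⟩) (fun j _ => by exact_mod_cast hL0.trans_le (hseg (w j)).1)
      (fun j _ hj => absurd hj (ENat.natCast_ne_top _))
  simp only [ENat.natCast_lt_top, ENat.toNat_natCast, Nat.cast_lt, forall_const] at htr
  have hrate : 0 < entropyRate 𝔙 (γ / 8) := by
    refine entropyRate_pos_of_two_pow_le (T := L + M + M) (by omega) fun N => ?_
    let ext (w : Fin N → Bool) (j : ℕ) : Bool := if h : j < N then w ⟨j, h⟩ else false
    have key := card_le_spanNum (𝔙 := 𝔙) (n := (N + 1) * (L + M + M)) (ε := γ / 8)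
      (fun w : Fin N → Bool => z (ext w)) (fun w => ψ (ext w))
      (fun w => ⟨hψ _, hz _⟩) ?_
    · simpa using key
    intro a b hab
    have hw : ∃ j < N, ext a j ≠ ext b j := by
      obtain ⟨j, hj⟩ := Function.ne_iff.1 hab
      exact ⟨j, j.2, by simpa [ext] using hj⟩
    obtain ⟨i, hiN, hne, hlt, hlt'⟩ := exists_gapStart_ne (L := L) (ht (ext a)) (ht (ext b)) hw
    have hbound (w : ℕ → Bool) :
        gapStart (fun j => segLength L M (w j)) (t w) i + L ≤ (N + 1) * (L + M + M) := by
      have h1 := gapStart_le (fun j => (hseg (w j)).2) (fun j => (ht w j).2) i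
      have h2 := Nat.mul_le_mul_right (L + M + M) hiN
      rw [add_mul, one_mul]
      omega
    rcases hne.lt_or_gt with hs | hs
    · obtain ⟨q, hq, hd⟩ := exists_le_dist_of_trace_lt hs (hseg _).1 (hseg _).1
        ⟨_, hL _ (by omega), hk _ (by omega)⟩ (htr (ext a) i) (htr (ext b) i)
      exact ⟨q, hq.trans_le (hbound _), by linarith⟩
    · obtain ⟨q, hq, hd⟩ := exists_le_dist_of_trace_lt hs (hseg _).1 (hseg _).1
        ⟨_, hL _ (by omega), hk _ (by omega)⟩ (htr (ext b) i) (htr (ext a) i)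
      rw [dist_comm] at hd
      exact ⟨q, hq.trans_le (hbound _), by linarith⟩
  exact hrate.trans_le (le_iSup₂ (f := fun (ε : ℝ) (_ : 0 < ε) => entropyRate 𝔙 ε)
    (γ / 8) (by positivity))
end

section
/- Let (X,𝔙) be an iterated function system and v ∈ 𝔙 such that the n-fold composition v^n belongs to 𝔙 for every n ∈ ℕ and mdim(X,𝔙,σ_v) > 0, where σ_v = (v,v,v,…). Then mdim(X,𝔙) = +∞. -/
open Filter Topology Set
open scoped ENat ENNReal

namespace IFS

variable {X : Type*} [MetricSpace X]

/-- Composition of two partial maps of an IFS: `(v.comp w)(x) = v(w(x))` on the natural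
domain `D(w) ∩ w^{-1}(D(v))`. -/
def IFSMap.comp (v w : IFSMap X) : IFSMap X where
  dom := w.dom ∩ w.toFun ⁻¹' v.dom
  toFun := v.toFun ∘ w.toFun
  closed_dom := w.contOn.preimage_isClosed_of_isClosed w.closed_dom v.closed_dom
  injOn := fun a ha b hb hab => w.injOn ha.1 hb.1 (v.injOn ha.2 hb.2 hab)
  contOn := v.contOn.comp (w.contOn.mono Set.inter_subset_left) (fun _ hx => hx.2)

/-- `IFSMap.pow v n` is the `n`-fold composition `v^n` (with `v^0` the identity). -/
def IFSMap.pow (v : IFSMap X) : ℕ → IFSMap X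
  | 0 => ⟨Set.univ, id, isClosed_univ, Set.injOn_id _, continuousOn_id⟩
  | n + 1 => IFSMap.comp v (IFSMap.pow v n)

end IFS

namespace IFS

variable {X : Type*} [MetricSpace X]

theorem mem_coverUpTo_iff (σ : ℕ → IFSMap X) (α : Set (Set X)) (n : ℕ) (W : Set X) :
    W ∈ coverUpTo σ α n ↔
      ∃ u : ℕ → Set X, (∀ k ≤ n, u k ∈ α) ∧ W = ⋂ k ≤ n, preimageN σ k (u k) := by
  induction n generalizing W with
  | zero =>
    simp only [coverUpTo, coverPull, Set.mem_image, Nat.le_zero_eq, forall_eq, iInter_iInter_eq_left]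
    constructor
    · rintro ⟨U, hU, rfl⟩
      exact ⟨fun _ => U, hU, rfl⟩
    · rintro ⟨u, hu, rfl⟩
      exact ⟨u 0, hu, rfl⟩
  | succ n ih =>
    simp only [coverUpTo, coverJoin, coverPull, Set.mem_image2, Set.exists_mem_image]
    constructor
    · rintro ⟨W', hW', U, hU, rfl⟩
      obtain ⟨u, hu, rfl⟩ := (ih W').1 hW'
      refine ⟨fun k => if k ≤ n then u k else U, fun k _ => ?_, ?_⟩
      · by_cases h : k ≤ n
        · simpa [h] using hu k h
        · simpa [h] using hU
      · rw [Set.biInter_le_succ]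
        congr 1
        · exact Set.iInter₂_congr fun k hk => by simp [hk]
        · simp
    · rintro ⟨u, hu, rfl⟩
      exact ⟨_, (ih _).2 ⟨u, fun k hk => hu k (by omega), rfl⟩, u (n + 1), hu _ le_rfl,
        (Set.biInter_le_succ _ n).symm⟩

theorem finite_coverUpTo (σ : ℕ → IFSMap X) {α : Set (Set X)} (hα : α.Finite) (n : ℕ) :
    (coverUpTo σ α n).Finite := by
  induction n with
  | zero => exact hα.image _
  | succ n ih => exact ih.image2 _ (hα.image _)

theorem isClosed_definedUpTo_and_continuousOn (σ : ℕ → IFSMap X) (n : ℕ) :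
    IsClosed {x | DefinedUpTo σ n x} ∧
      ContinuousOn (fun x => orbitIter σ x n) {x | DefinedUpTo σ n x} := by
  induction n with
  | zero =>
    have h : {x | DefinedUpTo σ 0 x} = Set.univ := by simp [DefinedUpTo]
    rw [h]
    exact ⟨isClosed_univ, continuousOn_id⟩
  | succ n ih =>
    have h : {x | DefinedUpTo σ (n + 1) x} =
        {x | DefinedUpTo σ n x} ∩ (fun x => orbitIter σ x n) ⁻¹' (σ n).dom := by
      ext x
      exact Nat.forall_lt_succ_right
    rw [h]
    exact ⟨ih.2.preimage_isClosed_of_isClosed ih.1 (σ n).closed_dom,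
      (σ n).contOn.comp (ih.2.mono Set.inter_subset_left) fun _ hx => hx.2⟩

theorem isClosed_sigmaSet (σ : ℕ → IFSMap X) : IsClosed (SigmaSet σ) := by
  have h : SigmaSet σ = ⋂ n, {x | DefinedUpTo σ n x} := by
    ext x
    simp only [SigmaSet, WellDef, DefinedUpTo, Set.mem_iInter, Set.mem_ofPred_eq]
    exact ⟨fun h n k _ => h k, fun h n => h (n + 1) n n.lt_succ_self⟩
  rw [h]
  exact isClosed_iInter fun n => (isClosed_definedUpTo_and_continuousOn σ n).1

theorem isOpen_preimageN_union_compl (σ : ℕ → IFSMap X) (n : ℕ) {U : Set X} (hU : IsOpen U) :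
    IsOpen (preimageN σ n U ∪ (SigmaSet σ)ᶜ) := by
  have hc : ContinuousOn (fun x => orbitIter σ x n) (SigmaSet σ) :=
    (isClosed_definedUpTo_and_continuousOn σ n).2.mono fun x hx k _ => hx k
  obtain ⟨V, hV, h⟩ := continuousOn_iff'.1 hc U hU
  have h' : preimageN σ n U ∪ (SigmaSet σ)ᶜ = V ∪ (SigmaSet σ)ᶜ := by
    ext x
    by_cases hx : x ∈ SigmaSet σ
    · have hd : DefinedUpTo σ n x := fun k _ => hx k
      have := Set.ext_iff.1 h x
      simp only [Set.mem_inter_iff, hx, and_true, Set.mem_preimage] at this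
      simp [hx, preimageN, hd, this]
    · simp [hx]
  rw [h']
  exact hV.union (isClosed_sigmaSet σ).isOpen_compl

/-- The join `α_0^n(σ)`, enlarged by the complement of `Σ_σ`, is an open cover of `X`. -/
theorem isOpenCoverOn_coverUpTo_union_compl (σ : ℕ → IFSMap X) {α : Set (Set X)}
    (hα : IsOpenCoverOn Set.univ α) (n : ℕ) :
    IsOpenCoverOn Set.univ ((· ∪ (SigmaSet σ)ᶜ) '' coverUpTo σ α n) := by
  obtain ⟨hfin, hopen, hcov⟩ := hα
  refine ⟨(finite_coverUpTo σ hfin n).image _, ?_, fun x _ => ?_⟩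
  · rintro _ ⟨W, hW, rfl⟩
    refine ⟨_, ?_, rfl⟩
    obtain ⟨u, hu, rfl⟩ := (mem_coverUpTo_iff σ α n W).1 hW
    simp only [Set.iInter₂_union]
    refine (Set.finite_Iic n).isOpen_biInter fun k hk => isOpen_preimageN_union_compl σ k ?_
    obtain ⟨V, hV, h⟩ := hopen _ (hu k hk)
    simp only [Set.inter_univ] at h
    exact h ▸ hV
  · choose u hu hxu using fun k => hcov (Set.mem_univ (orbitIter σ x k))
    refine ⟨_, ⟨_, (mem_coverUpTo_iff σ α n _).2 ⟨u, fun k _ => hu k, rfl⟩, rfl⟩, ?_⟩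
    by_cases hx : x ∈ SigmaSet σ
    · exact Or.inl (Set.mem_iInter₂.2 fun k _ => ⟨fun j _ => hx j, hxu k⟩)
    · exact Or.inr hx

/-- `𝒟` only depends on refinement relative to the covered set. -/
theorem coverD_le_coverD {A : Set X} {α γ : Set (Set X)}
    (h : ∀ U ∈ γ, ∃ V ∈ α, U ∩ A ⊆ V) : coverD A α ≤ coverD A γ := by
  refine le_iInf₂ fun β hβ => ?_
  obtain ⟨⟨hfin, hopen, hcov⟩, href⟩ := hβ
  have hβ' : IsOpenCoverOn A ((· ∩ A) '' β) ∧ Refines ((· ∩ A) '' β) α := by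
    refine ⟨⟨hfin.image _, ?_, fun x hx => ?_⟩, ?_⟩
    · rintro _ ⟨U, hU, rfl⟩
      obtain ⟨V, hV, h⟩ := hopen U hU
      exact ⟨V, hV, by simpa [Set.inter_assoc] using h⟩
    · obtain ⟨U, hU, hxU⟩ := hcov hx
      exact ⟨_, ⟨U, hU, rfl⟩, hxU, hx⟩
    · rintro _ ⟨U, hU, rfl⟩
      obtain ⟨V, hV, hUV⟩ := href U hU
      obtain ⟨V', hV', hV'V⟩ := h V hV
      exact ⟨V', hV', (Set.inter_subset_inter_left A hUV).trans hV'V⟩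
  refine (iInf₂_le (f := fun β _ => ordOn A β) _ hβ').trans (tsub_le_tsub_right (iSup₂_mono fun x _ => ?_) 1)
  refine (Set.encard_le_encard ?_).trans (Set.encard_image_le (· ∩ A) {U ∈ β | x ∈ U})
  rintro _ ⟨⟨U, hU, rfl⟩, hxU⟩
  exact ⟨U, ⟨hU, hxU.1⟩, rfl⟩

theorem orbitIter_const (v : IFSMap X) (x : X) (n : ℕ) :
    orbitIter (fun _ => v) x n = v.toFun^[n] x := by
  induction n with
  | zero => rfl
  | succ n ih => rw [Function.iterate_succ_apply', orbitIter, ih]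

theorem pow_toFun (v : IFSMap X) (p : ℕ) : (IFSMap.pow v p).toFun = v.toFun^[p] := by
  induction p with
  | zero => rfl
  | succ p ih => rw [Function.iterate_succ', ← ih]; rfl

theorem mem_pow_dom_iff (v : IFSMap X) (p : ℕ) (x : X) :
    x ∈ (IFSMap.pow v p).dom ↔ ∀ j < p, v.toFun^[j] x ∈ v.dom := by
  induction p with
  | zero => simp [IFSMap.pow]
  | succ p ih =>
    rw [Nat.forall_lt_succ_right, ← ih, ← pow_toFun]
    rfl

theorem orbitIter_const_pow (v : IFSMap X) (p : ℕ) (x : X) (n : ℕ) :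
    orbitIter (fun _ => IFSMap.pow v p) x n = v.toFun^[p * n] x := by
  rw [orbitIter_const, pow_toFun, Function.iterate_mul]

theorem sigmaSet_const_pow (v : IFSMap X) {p : ℕ} (hp : 1 ≤ p) :
    SigmaSet (fun _ => IFSMap.pow v p) = SigmaSet (fun _ => v) := by
  ext x
  simp only [SigmaSet, WellDef, Set.mem_ofPred_eq, orbitIter_const_pow, orbitIter_const,
    mem_pow_dom_iff, ← Function.iterate_add_apply]
  refine ⟨fun h n => ?_, fun h n j _ => h _⟩
  simpa [Nat.mod_add_div] using h (n / p) (n % p) (Nat.mod_lt n hp)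

theorem orbitIter_mem_sigmaSet_const {v : IFSMap X} {x : X} (hx : x ∈ SigmaSet (fun _ => v))
    (n : ℕ) : v.toFun^[n] x ∈ SigmaSet (fun _ => v) := by
  intro k
  have := hx (k + n)
  rw [orbitIter_const] at this ⊢
  rw [← Function.iterate_add_apply]
  exact this

/-- Comparison of the joins of `v` with the joins of `v^(q+1)` along blocks of length `q+1`. -/
theorem coverD_coverUpTo_le_pow (v : IFSMap X) (α : Set (Set X)) (q n m : ℕ)
    (hm : m / (q + 1) = n) :
    coverD (SigmaSet fun _ => v) (coverUpTo (fun _ => v) α m) ≤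
      coverD (SigmaSet fun _ => IFSMap.pow v (q + 1))
        (coverUpTo (fun _ => IFSMap.pow v (q + 1))
          ((· ∪ (SigmaSet fun _ => v)ᶜ) '' coverUpTo (fun _ => v) α q) n) := by
  rw [sigmaSet_const_pow v (Nat.le_add_left 1 q)]
  refine coverD_le_coverD fun U hU => ?_
  obtain ⟨w, hw, rfl⟩ := (mem_coverUpTo_iff _ _ n U).1 hU
  have hw' : ∀ k, ∃ u : ℕ → Set X, k ≤ n → (∀ j ≤ q, u j ∈ α) ∧
      w k = (⋂ j ≤ q, preimageN (fun _ => v) j (u j)) ∪ (SigmaSet fun _ => v)ᶜ := by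
    intro k
    by_cases hk : k ≤ n
    · obtain ⟨W, hW, hWk⟩ := hw k hk
      obtain ⟨u, hu, rfl⟩ := (mem_coverUpTo_iff _ _ q W).1 hW
      exact ⟨u, fun _ => ⟨hu, hWk.symm⟩⟩
    · exact ⟨fun _ => ∅, fun h => absurd h hk⟩
  choose u hu using hw'
  have hdiv : ∀ i ≤ m, i / (q + 1) ≤ n := fun i hi => hm ▸ Nat.div_le_div_right hi
  have hmod : ∀ i, i % (q + 1) ≤ q := fun i => Nat.le_of_lt_succ (Nat.mod_lt i q.succ_pos)
  refine ⟨_, (mem_coverUpTo_iff _ α m _).2 ⟨fun i => u (i / (q + 1)) (i % (q + 1)),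
    fun i hi => (hu _ (hdiv i hi)).1 _ (hmod i), rfl⟩, ?_⟩
  rintro x ⟨hxU, hx⟩
  refine Set.mem_iInter₂.2 fun i hi => ⟨fun k _ => hx k, ?_⟩
  have h := (Set.mem_iInter₂.1 hxU _ (hdiv i hi)).2
  rw [(hu _ (hdiv i hi)).2, orbitIter_const_pow] at h
  have h' := (Set.mem_iInter₂.1 (h.resolve_right
    (not_not.2 (orbitIter_mem_sigmaSet_const hx _))) _ (hmod i)).2
  rwa [orbitIter_const, ← Function.iterate_add_apply, Nat.mod_add_div, ← orbitIter_const] at h'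

theorem mul_mdimAlong_le_two_mul_mdimAlong_pow (v : IFSMap X) (q : ℕ) :
    ((q + 1 : ℕ) : ℝ≥0∞) * mdimAlong (fun _ => v) ≤
      2 * mdimAlong (fun _ => IFSMap.pow v (q + 1)) := by
  simp only [mdimAlong, ENNReal.mul_iSup]
  refine iSup₂_le fun α hα => ?_
  set γ : Set (Set X) := (· ∪ (SigmaSet fun _ => v)ᶜ) '' coverUpTo (fun _ => v) α q with hγ
  refine le_trans ?_ (le_iSup₂ (f := fun γ _ => 2 * mdimCover (fun _ => IFSMap.pow v (q + 1)) γ) γ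
    (isOpenCoverOn_coverUpTo_union_compl (fun _ => v) hα q))
  simp only [mdimCover]
  rw [← ENNReal.limsup_const_mul_of_ne_top (ENNReal.natCast_ne_top _),
    ← ENNReal.limsup_const_mul_of_ne_top ENNReal.ofNat_ne_top]
  refine le_trans ?_ (limsup_le_limsup_of_le
    (Nat.tendsto_div_const_atTop (Nat.succ_ne_zero q)))
  rw [← limsup_comp]
  refine limsup_le_limsup ?_
  filter_upwards [eventually_ge_atTop (q + 1)] with m hm
  have hD := ENat.toENNReal_le.2 (coverD_coverUpTo_le_pow v α q _ m rfl)
  have hn : 1 ≤ m / (q + 1) := (Nat.one_le_div_iff q.succ_pos).2 hm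
  have hle : (q + 1) * (m / (q + 1)) ≤ m := Nat.mul_div_le m (q + 1)
  simp only [Function.comp_apply]
  rw [← hγ] at hD
  generalize m / (q + 1) = n at hn hle hD ⊢
  have hnat : (q + 1) * (n + 1) ≤ 2 * (m + 1) := by nlinarith
  have hcast : ((q + 1 : ℕ) : ℝ≥0∞) * (n + 1) ≤ 2 * (m + 1) := by exact_mod_cast hnat
  have hn0 : (n : ℝ≥0∞) + 1 ≠ 0 := by simp
  have hm0 : (m : ℝ≥0∞) + 1 ≠ 0 := by simp
  have hnt : (n : ℝ≥0∞) + 1 ≠ ⊤ := by simp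
  have hmt : (m : ℝ≥0∞) + 1 ≠ ⊤ := by simp
  have hq : ((q + 1 : ℕ) : ℝ≥0∞) / (m + 1) ≤ 2 / (n + 1) := by
    rw [ENNReal.div_le_iff hm0 hmt, ← ENNReal.mul_div_right_comm, ENNReal.le_div_iff_mul_le
      (Or.inl hn0) (Or.inl hnt)]
    exact hcast
  calc _ = ((q + 1 : ℕ) : ℝ≥0∞) / (m + 1) * _ := by rw [ENNReal.mul_comm_div]
    _ ≤ 2 / (n + 1) * _ := mul_le_mul' hq hD
    _ = _ := by rw [ENNReal.mul_comm_div]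

end IFS

open IFS in
/-- If `v^n ∈ 𝔙` for every `n ∈ ℕ` and `mdim(X,𝔙,σ_v) > 0`, then `mdim(X,𝔙) = +∞`. -/
theorem mdim_eq_top_of_pow_mem {X : Type*} [MetricSpace X] [CompactSpace X]
    (𝔙 : Set (IFSMap X)) (hIFS : IsIFS 𝔙) (v : IFSMap X) (hv : v ∈ 𝔙)
    (hpow : ∀ n : ℕ, 1 ≤ n → IFSMap.pow v n ∈ 𝔙)
    (hpos : 0 < mdimAlong (fun _ : ℕ => v)) :
    mdim 𝔙 = ⊤ := by
  by_contra hne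
  obtain ⟨n, hn⟩ := ENNReal.exists_nat_mul_gt hpos.ne'
    (ENNReal.mul_ne_top (ENNReal.ofNat_ne_top (n := 2)) hne)
  refine absurd hn (not_lt.2 ?_)
  calc (n : ℝ≥0∞) * mdimAlong (fun _ : ℕ => v)
      ≤ ((n + 1 : ℕ) : ℝ≥0∞) * mdimAlong (fun _ : ℕ => v) := by gcongr; exact n.le_succ
    _ ≤ 2 * mdimAlong (fun _ : ℕ => IFSMap.pow v (n + 1)) :=
      mul_mdimAlong_le_two_mul_mdimAlong_pow v n
    _ ≤ 2 * mdim 𝔙 := by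
      gcongr
      exact le_iSup₂ (f := fun σ _ => mdimAlong σ) (fun _ : ℕ => IFSMap.pow v (n + 1))
        fun _ => hpow (n + 1) (Nat.le_add_left 1 n)
end

section
/- Let (X,𝔙) be an iterated function system. Then mdim(X,𝔙) ≤ omdim(X,𝔙). -/
open Filter Topology Set
open scoped ENat ENNReal

namespace IFS

variable {X : Type*} [MetricSpace X]

/-- Given for each `y ∈ E` and each coordinate at most one forbidden value out of `q`, some choice
of values hits the forbidden ones few times, for every `y` simultaneously. -/
theorem exists_forall_pow_card_le {ι J : Type*} [Fintype J] (E : Finset ι) {q : ℕ} (hq : 0 < q)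
    (P : ι → J → Fin q → Prop) [∀ y j, DecidablePred (P y j)]
    (hP : ∀ y j c c', P y j c → P y j c' → c = c') :
    ∃ ξ : J → Fin q, ∀ y ∈ E,
      q ^ (Finset.univ.filter fun j => P y j (ξ j)).card ≤ E.card * 2 ^ Fintype.card J := by
  classical
  have : NeZero q := ⟨hq.ne'⟩
  set w : ι → (J → Fin q) → ℕ := fun y ξ => ∏ j, if P y j (ξ j) then q else 1 with hw
  have hw' : ∀ y ξ, w y ξ = q ^ (Finset.univ.filter fun j => P y j (ξ j)).card := by
    intro y ξ
    simp [hw, Finset.prod_ite]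
  have hcol : ∀ y j, ∑ c, (if P y j c then q else 1) ≤ 2 * q := by
    intro y j
    have h1 : (Finset.univ.filter fun c => P y j c).card ≤ 1 := by
      rw [Finset.card_le_one]
      intro a ha b hb
      exact hP y j a b (by simpa using ha) (by simpa using hb)
    calc ∑ c, (if P y j c then q else 1)
        ≤ ∑ c, ((if P y j c then q else 0) + 1) := by
          gcongr with c; split_ifs <;> simp
      _ = (Finset.univ.filter fun c => P y j c).card * q + q := by
          rw [Finset.sum_add_distrib, ← Finset.sum_filter]; simp
      _ ≤ 2 * q := by nlinarith
  have hsum : ∀ y, ∑ ξ, w y ξ ≤ (2 * q) ^ Fintype.card J := by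
    intro y
    calc ∑ ξ, w y ξ = ∏ j, ∑ c, (if P y j c then q else 1) := by
          rw [Finset.prod_univ_sum]; simp [hw]
      _ ≤ ∏ _j : J, (2 * q) := Finset.prod_le_prod' fun j _ => hcol y j
      _ = _ := by simp
  have htot : ∑ ξ, ∑ y ∈ E, w y ξ ≤ ∑ _ξ : J → Fin q, E.card * 2 ^ Fintype.card J := by
    rw [Finset.sum_comm]
    calc ∑ y ∈ E, ∑ ξ, w y ξ ≤ ∑ _y ∈ E, (2 * q) ^ Fintype.card J :=
          Finset.sum_le_sum fun y _ => hsum y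
      _ = _ := by simp [mul_pow]; ring
  obtain ⟨ξ, -, hξ⟩ := Finset.exists_le_of_sum_le Finset.univ_nonempty htot
  refine ⟨ξ, fun y hy => ?_⟩
  rw [← hw']
  exact (Finset.single_le_sum (f := fun y => w y ξ) (fun _ _ => Nat.zero_le _) hy).trans hξ

/-- The set of points whose coordinates `j` with `φ j = 0` are closest to `ξ` (and `η`-close), the
other ones lying on the side of `ξ` prescribed by `φ j`. -/
def cell {Y J : Type*} (g : J → Y → ℝ) (ξ : J → ℝ) (η : ℝ) (φ : J → SignType) : Set Y :=
  {x | (∀ j, φ j = 0 → |g j x - ξ j| < η) ∧ (∀ j, φ j = 1 → ξ j < g j x) ∧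
    (∀ j, φ j = -1 → g j x < ξ j) ∧
    ∀ i j, φ i = 0 → φ j ≠ 0 → |g i x - ξ i| < |g j x - ξ j|}

theorem isOpen_cell {Y J : Type*} [TopologicalSpace Y] [Finite J] {g : J → Y → ℝ}
    (hg : ∀ j, Continuous (g j)) (ξ : J → ℝ) (η : ℝ) (φ : J → SignType) :
    IsOpen (cell g ξ η φ) := by
  have hr : ∀ j, Continuous fun x => |g j x - ξ j| := fun j =>
    ((hg j).sub continuous_const).abs
  simp only [cell, ofPred_and, ofPred_forall]
  refine IsOpen.inter ?_ (IsOpen.inter ?_ (IsOpen.inter ?_ ?_))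
  · exact isOpen_iInter_of_finite fun j => isOpen_iInter_of_finite fun _ =>
      isOpen_lt (hr j) continuous_const
  · exact isOpen_iInter_of_finite fun j => isOpen_iInter_of_finite fun _ =>
      isOpen_lt continuous_const (hg j)
  · exact isOpen_iInter_of_finite fun j => isOpen_iInter_of_finite fun _ =>
      isOpen_lt (hg j) continuous_const
  · exact isOpen_iInter_of_finite fun i => isOpen_iInter_of_finite fun j =>
      isOpen_iInter_of_finite fun _ => isOpen_iInter_of_finite fun _ => isOpen_lt (hr i) (hr j)

theorem exists_mem_cell {Y J : Type*} (g : J → Y → ℝ) (ξ : J → ℝ) {η : ℝ} (hη : 0 < η) (x : Y) :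
    ∃ φ, x ∈ cell g ξ η φ := by
  classical
  refine ⟨fun j => if |g j x - ξ j| < η then 0 else SignType.sign (g j x - ξ j), ?_, ?_, ?_, ?_⟩
  · intro j hj
    by_contra h
    simp only [h, if_false, sign_eq_zero_iff] at hj
    simp [hj, hη] at h
  · intro j hj
    beta_reduce at hj
    split_ifs at hj
    · exact sub_pos.1 (sign_eq_one_iff.1 hj)
  · intro j hj
    beta_reduce at hj
    split_ifs at hj
    · exact sub_neg.1 (sign_eq_neg_one_iff.1 hj)
  · intro i j hi hj
    have hj' : η ≤ |g j x - ξ j| := by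
      by_contra h
      simp [not_le.1 h] at hj
    refine lt_of_lt_of_le ?_ hj'
    by_contra h
    simp only [h, if_false, sign_eq_zero_iff] at hi
    simp [hi, hη] at h

theorem eq_of_mem_cell {Y J : Type*} [Fintype J] {g : J → Y → ℝ} {ξ : J → ℝ} {η : ℝ}
    {x : Y} {φ ψ : J → SignType} (hφ : x ∈ cell g ξ η φ) (hψ : x ∈ cell g ξ η ψ)
    (h : (Finset.univ.filter fun j => φ j = 0).card = (Finset.univ.filter fun j => ψ j = 0).card) :
    φ = ψ := by
  obtain ⟨-, a2, a3, a4⟩ := hφ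
  obtain ⟨-, b2, b3, b4⟩ := hψ
  have key : ∀ j, φ j = 0 ↔ ψ j = 0 := by
    have : (Finset.univ.filter fun j => φ j = 0) = Finset.univ.filter fun j => ψ j = 0 := by
      by_cases hs : (Finset.univ.filter fun j => φ j = 0) ⊆ Finset.univ.filter fun j => ψ j = 0
      · exact Finset.eq_of_subset_of_card_le hs h.ge
      · refine (Finset.eq_of_subset_of_card_le (fun j hj => ?_) h.le).symm
        obtain ⟨i, hi, hi'⟩ := Finset.not_subset.1 hs
        simp only [Finset.mem_filter, Finset.mem_univ, true_and] at hi hi' hj ⊢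
        by_contra hj'
        exact lt_asymm (a4 i j hi hj') (b4 j i hj hi')
    intro j
    simpa using congrArg (j ∈ ·) this
  funext j
  have k := key j
  have a2 := a2 j
  have a3 := a3 j
  have b2 := b2 j
  have b3 := b3 j
  generalize φ j = u at *
  generalize ψ j = v at *
  rcases u with _ | _ | _ <;> rcases v with _ | _ | _ <;> simp_all <;> linarith

theorem encard_setOf_mem_cell_le {Y J : Type*} [Fintype J] {g : J → Y → ℝ} {ξ : J → ℝ}
    {η : ℝ} {x : Y} {Z : ℕ} (hZ : (Finset.univ.filter fun j => |g j x - ξ j| < η).card ≤ Z) :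
    {φ | x ∈ cell g ξ η φ}.encard ≤ Z + 1 := by
  have := Set.encard_le_encard_of_injOn (s := {φ | x ∈ cell g ξ η φ})
    (t := (Finset.range (Z + 1) : Set ℕ))
    (f := fun φ => (Finset.univ.filter fun j => φ j = 0).card) ?_ ?_
  · simpa only [Set.encard_coe_eq_coe_finsetCard, Finset.card_range, Nat.cast_add, Nat.cast_one]
      using this
  · intro φ hφ
    simp only [Finset.coe_range, mem_Iio, Nat.lt_succ_iff]
    refine (Finset.card_le_card fun j hj => ?_).trans hZ
    simp only [Finset.mem_filter, Finset.mem_univ, true_and] at hj ⊢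
    exact hφ.1 j hj
  · intro φ hφ ψ hψ h
    exact eq_of_mem_cell hφ hψ h

theorem exists_cover_ordOn_le {J : Type*} [Finite J] (A : Set X)
    {g : J → X → ℝ} (hg : ∀ j, ContinuousOn (g j) A) (ξ : J → ℝ) {η : ℝ} (hη : 0 < η) {Z : ℕ}
    (hZ : ∀ x ∈ A, {j | |g j x - ξ j| < η}.ncard ≤ Z) :
    ∃ β : Set (Set X), IsOpenCoverOn A β ∧ ordOn A β ≤ Z ∧ ∀ W ∈ β, W.Nonempty ∧ W ⊆ A ∧
      ∀ j, (∀ x ∈ W, |g j x - ξ j| < η) ∨ (∀ x ∈ W, g j x < ξ j) ∨ (∀ x ∈ W, ξ j < g j x) := by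
  classical
  have := Fintype.ofFinite J
  refine ⟨{W | (∃ φ, A ∩ cell g ξ η φ = W) ∧ W.Nonempty}, ⟨?_, ?_, ?_⟩, ?_, ?_⟩
  · exact (Set.finite_range fun φ => A ∩ cell g ξ η φ).subset fun W hW => hW.1
  · rintro _ ⟨⟨φ, rfl⟩, -⟩
    have ho := isOpen_cell (g := fun j (x : A) => g j x)
      (fun j => continuousOn_iff_continuous_domRestrict.1 (hg j)) ξ η φ
    obtain ⟨V, hV, hVe⟩ := isOpen_induced_iff.1 ho
    refine ⟨V, hV, ?_⟩
    ext x
    constructor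
    · rintro ⟨⟨hx, hc⟩, -⟩
      have : (⟨x, hx⟩ : A) ∈ Subtype.val ⁻¹' V := by rw [hVe]; exact hc
      exact ⟨this, hx⟩
    · rintro ⟨hxV, hx⟩
      have : (⟨x, hx⟩ : A) ∈ Subtype.val ⁻¹' V := hxV
      rw [hVe] at this
      exact ⟨⟨hx, this⟩, hx⟩
  · intro x hx
    obtain ⟨φ, hφ⟩ := exists_mem_cell g ξ hη x
    exact ⟨_, ⟨⟨φ, rfl⟩, x, hx, hφ⟩, hx, hφ⟩
  · rw [ordOn, tsub_le_iff_right]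
    refine iSup₂_le fun x hx => ?_
    have hZx := hZ x hx
    rw [Set.ncard_eq_toFinset_card', Set.toFinset_ofPred] at hZx
    refine le_trans ?_ (encard_setOf_mem_cell_le hZx)
    refine (Set.encard_le_encard ?_).trans
      (Set.encard_image_le (fun φ => A ∩ cell g ξ η φ) {φ | x ∈ cell g ξ η φ})
    rintro _ ⟨⟨⟨φ, rfl⟩, -⟩, hxW⟩
    exact ⟨φ, hxW.2, rfl⟩
  · rintro _ ⟨⟨φ, rfl⟩, hne⟩
    refine ⟨hne, Set.inter_subset_left, fun j => ?_⟩
    rcases h : φ j with _ | _ | _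
    · exact Or.inl fun x hx => hx.2.1 j h
    · exact Or.inr (Or.inl fun x hx => hx.2.2.2.1 j h)
    · exact Or.inr (Or.inr fun x hx => hx.2.2.1 j h)

/-- A Lipschitz refinement of the indicator functions of the complements of a finite open cover. -/
theorem exists_lipschitz_of_isOpenCoverOn [CompactSpace X]
    {α : Set (Set X)} (hα : IsOpenCoverOn Set.univ α) :
    ∃ (K : ℝ) (g : Set X → X → ℝ), 0 < K ∧ (∀ U x y, |g U x - g U y| ≤ K * dist x y) ∧
      (∀ U x, g U x < 1 → x ∈ U) ∧ ∀ x, ∃ U ∈ α, g U x ≤ 0 := by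
  classical
  obtain ⟨-, ho, hc⟩ := hα
  obtain ⟨δ, hδ, hb⟩ := lebesgue_number_lemma_of_metric_sUnion isCompact_univ
    (fun U hU => by obtain ⟨V, hV, h⟩ := ho U hU; simp only [inter_univ] at h; rwa [h]) hc
  refine ⟨δ⁻¹, fun U x => if U = Set.univ then 0 else 1 - δ⁻¹ * Metric.infDist x Uᶜ,
    inv_pos.2 hδ, ?_, ?_, ?_⟩
  · intro U x y
    dsimp only
    split_ifs
    · simp only [sub_self, abs_zero]; positivity
    · have h := (Metric.lipschitz_infDist_pt Uᶜ).dist_le_mul x y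
      rw [Real.dist_eq, NNReal.coe_one, one_mul] at h
      calc _ = |δ⁻¹ * -(Metric.infDist x Uᶜ - Metric.infDist y Uᶜ)| := by congr 1; ring
        _ = δ⁻¹ * |Metric.infDist x Uᶜ - Metric.infDist y Uᶜ| := by
          rw [abs_mul, abs_neg, abs_of_pos (inv_pos.2 hδ)]
        _ ≤ _ := by gcongr
  · intro U x hx
    dsimp only at hx
    split_ifs at hx with h
    · simp [h]
    · by_contra hxU
      rw [Metric.infDist_zero_of_mem (show x ∈ Uᶜ from hxU)] at hx
      simp at hx
  · intro x
    obtain ⟨U, hU, hxU⟩ := hb x (Set.mem_univ x)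
    refine ⟨U, hU, ?_⟩
    dsimp only
    split_ifs with h
    · exact le_rfl
    · have hd : δ ≤ Metric.infDist x Uᶜ := by
        rw [Metric.le_infDist (Set.nonempty_compl.2 h)]
        intro y hy
        by_contra hlt
        exact hy (hxU (by rw [Metric.mem_ball, dist_comm]; exact not_le.1 hlt))
      have : 1 ≤ δ⁻¹ * Metric.infDist x Uᶜ := by
        rw [inv_mul_eq_div, le_div_iff₀ hδ]; linarith
      linarith

theorem exists_mem_coverUpTo (σ : ℕ → IFSMap X) {α : Set (Set X)} {W : Set X}
    (hW : W ⊆ SigmaSet σ) (n : ℕ)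
    (h : ∀ l ≤ n, ∃ U ∈ α, ∀ x ∈ W, orbitIter σ x l ∈ U) :
    ∃ V ∈ coverUpTo σ α n, W ⊆ V := by
  have aux : ∀ l, (∃ U ∈ α, ∀ x ∈ W, orbitIter σ x l ∈ U) → ∃ V ∈ coverPull σ l α, W ⊆ V := by
    rintro l ⟨U, hU, hWU⟩
    exact ⟨_, ⟨U, hU, rfl⟩, fun x hx => ⟨fun k _ => hW hx k, hWU x hx⟩⟩
  induction n with
  | zero => exact aux 0 (h 0 le_rfl)
  | succ n ih =>
    obtain ⟨V, hV, hWV⟩ := ih fun l hl => h l (hl.trans n.le_succ)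
    obtain ⟨V', hV', hWV'⟩ := aux (n + 1) (h _ le_rfl)
    exact ⟨_, ⟨V, hV, V', hV', rfl⟩, Set.subset_inter hWV hWV'⟩

/-- A spanning set at scale `ε` bounds the dimension of the iterated cover. -/
theorem exists_coverD_le (σ : ℕ → IFSMap X) {α : Set (Set X)} (hα : α.Finite) {K : ℝ}
    {g : Set X → X → ℝ} (hK : 0 < K) (hgK : ∀ U x y, |g U x - g U y| ≤ K * dist x y)
    (hg1 : ∀ U x, g U x < 1 → x ∈ U) (hg0 : ∀ x, ∃ U ∈ α, g U x ≤ 0)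
    {ε : ℝ} (hε : 0 < ε) {q : ℕ} (hq : 0 < q) (hqε : q * (4 * K * ε) ≤ 1) (n : ℕ) {E : Finset X}
    (hE : ∀ x ∈ SigmaSet σ, ∃ y ∈ E, ∀ i < n + 1, dist (orbitIter σ x i) (orbitIter σ y i) < ε)
    {N : ℝ} (hN : 1 ≤ N) (hEN : E.card ≤ N) :
    ∃ Z : ℕ, coverD (SigmaSet σ) (coverUpTo σ α n) ≤ Z ∧
      (q : ℝ) ^ Z ≤ N * 2 ^ (α.ncard * (n + 1)) := by
  classical
  have : Fintype α := hα.fintype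
  set G : α × Fin (n + 1) → X → ℝ := fun j x => g j.1 (orbitIter σ x j.2) with hG
  have hKε : 0 < K * ε := mul_pos hK hε
  obtain ⟨c, hc⟩ := exists_forall_pow_card_le E hq
    (fun y (j : α × Fin (n + 1)) (c : Fin q) => |G j y - c * (4 * K * ε)| < 2 * (K * ε)) (by
      intro y j a b ha hb
      rw [abs_lt] at ha hb
      have h1 : ((a : ℕ) : ℝ) < (b : ℕ) + 1 := by
        by_contra h; push Not at h; nlinarith
      have h2 : ((b : ℕ) : ℝ) < (a : ℕ) + 1 := by
        by_contra h; push Not at h; nlinarith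
      norm_cast at h1 h2
      exact Fin.ext (by omega))
  set ξ : α × Fin (n + 1) → ℝ := fun j => (c j : ℕ) * (4 * K * ε) with hξ
  set cnt : X → ℕ := fun y =>
    (Finset.univ.filter fun j => |G j y - ξ j| < 2 * (K * ε)).card with hcnt
  have hcard : Fintype.card (α × Fin (n + 1)) = α.ncard * (n + 1) := by
    rw [Fintype.card_prod, Fintype.card_fin, ← Nat.card_eq_fintype_card, Nat.card_coe_set_eq]
  refine ⟨E.sup cnt, ?_, ?_⟩
  · obtain ⟨β, hβ, hord, hβW⟩ := exists_cover_ordOn_le (SigmaSet σ) (g := G) (Z := E.sup cnt)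
      (fun j => by
        have hcont : Continuous (g j.1) :=
          (LipschitzWith.of_dist_le_mul (K := ⟨K, hK.le⟩) fun x y => by
            rw [Real.dist_eq]; exact hgK _ x y).continuous
        exact hcont.comp_continuousOn (continuousOn_orbitIter σ j.2)) ξ hKε (by
      intro x hx
      obtain ⟨y, hy, hxy⟩ := hE x hx
      refine le_trans ?_ (Finset.le_sup hy)
      rw [Set.ncard_eq_toFinset_card', Set.toFinset_ofPred]
      refine Finset.card_le_card fun j hj => ?_
      simp only [Finset.mem_filter, Finset.mem_univ, true_and] at hj ⊢
      have h1 : |G j x - G j y| ≤ K * ε := (hgK _ _ _).trans (by gcongr; exact (hxy _ j.2.2).le)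
      rw [abs_lt] at hj ⊢
      rw [abs_le] at h1
      constructor <;> linarith [h1.1, h1.2, hj.1, hj.2])
    refine (iInf₂_le β ⟨hβ, fun W hW => ?_⟩).trans hord
    obtain ⟨⟨x₀, hx₀⟩, hWA, hside⟩ := hβW W hW
    refine exists_mem_coverUpTo σ hWA n fun l hl => ?_
    obtain ⟨U, hU, hUx⟩ := hg0 (orbitIter σ x₀ l)
    refine ⟨U, hU, fun x hx => hg1 U _ ?_⟩
    set j : α × Fin (n + 1) := (⟨U, hU⟩, ⟨l, Nat.lt_succ_of_le hl⟩) with hj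
    have hξ0 : 0 ≤ ξ j := by positivity
    have hξ1 : ξ j + 4 * K * ε ≤ 1 := by
      have : ((c j : ℕ) : ℝ) + 1 ≤ q := by exact_mod_cast (c j).2
      calc ξ j + 4 * K * ε = ((c j : ℕ) + 1 : ℝ) * (4 * K * ε) := by simp only [hξ]; ring
        _ ≤ q * (4 * K * ε) := by gcongr
        _ ≤ 1 := hqε
    have hUx' : G j x₀ ≤ 0 := hUx
    change G j x < 1
    rcases hside j with h | h | h
    · have := (abs_lt.1 (h x hx)).2
      linarith
    · have := h x hx
      linarith
    · have := h x₀ hx₀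
      linarith
  · rcases E.eq_empty_or_nonempty with rfl | hne
    · simp only [Finset.sup_empty, Nat.bot_eq_zero, pow_zero]
      exact one_le_mul_of_one_le_of_one_le hN (one_le_pow₀ one_le_two)
    · obtain ⟨y, hy, hye⟩ := E.exists_mem_eq_sup hne cnt
      rw [hye, ← hcard]
      calc (q : ℝ) ^ cnt y ≤ (E.card : ℝ) * 2 ^ Fintype.card (α × Fin (n + 1)) := by
            exact_mod_cast hc y hy
        _ ≤ _ := by gcongr

/-- A bound on the number of separated points provides a spanning set of that size. -/
theorem exists_spanning_of_sepNum_le (σ : ℕ → IFSMap X) (n : ℕ) {ε : ℝ} (hε : 0 < ε)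
    {N : ℝ} (hN : 0 ≤ N)
    (h : sepNum σ n ε ≤ ENNReal.ofReal N) :
    ∃ E : Finset X, (E.card : ℝ) ≤ N ∧
      ∀ x ∈ SigmaSet σ, ∃ y ∈ E, ∀ i < n, dist (orbitIter σ x i) (orbitIter σ y i) < ε := by
  classical
  have hb : ∀ E : Finset X, IsSeparatedAlong σ n ε E → (E.card : ℝ) ≤ N := by
    intro E hE
    have h1 : ((E : Set X).encard : ℝ≥0∞) ≤ ENNReal.ofReal N :=
      (le_iSup₂ (f := fun (S : Set X) (_ : IsSeparatedAlong σ n ε S) => (S.encard : ℝ≥0∞))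
        (E : Set X) hE).trans h
    rw [Set.encard_coe_eq_coe_finsetCard] at h1
    simpa [ENNReal.natCast_le_ofReal, ENNReal.le_ofReal_iff_toReal_le, hN] using h1
  by_contra hcon
  push Not at hcon
  have key : ∀ m : ℕ, ∃ E : Finset X, IsSeparatedAlong σ n ε E ∧ E.card = m := by
    intro m
    induction m with
    | zero => exact ⟨∅, ⟨by simp, by simp⟩, rfl⟩
    | succ m ih =>
      obtain ⟨E, hE, rfl⟩ := ih
      obtain ⟨x, hx, hxE⟩ := hcon E (hb E hE)
      have hxE' : x ∉ E := fun hmem => by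
        obtain ⟨i, -, hi⟩ := hxE x hmem
        rw [dist_self] at hi
        exact absurd hi (not_le.2 hε)
      refine ⟨insert x E, ⟨?_, ?_⟩, Finset.card_insert_of_notMem hxE'⟩
      · intro y hy
        rcases Finset.mem_insert.1 hy with rfl | hy
        · exact hx
        · exact hE.1 y hy
      · intro y hy z hz hyz
        rcases Finset.mem_insert.1 hy with rfl | hyE <;>
          rcases Finset.mem_insert.1 hz with rfl | hzE
        · exact absurd rfl hyz
        · exact hxE z hzE
        · simpa only [dist_comm] using hxE y hyE
        · exact hE.2 y hyE z hzE hyz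
  obtain ⟨m, hm⟩ := exists_nat_gt N
  obtain ⟨E, hE, rfl⟩ := key m
  exact absurd (hb E hE) (not_le.2 hm)

theorem lt_coe_mul_of_inv_mul_lt {a D : ℝ} (ha : 0 < a) {r : EReal}
    (h : ((a⁻¹ : ℝ) : EReal) * r < D) : r < ((a * D : ℝ) : EReal) := by
  by_contra hr
  have h1 : ((a⁻¹ : ℝ) : EReal) * ((a * D : ℝ) : EReal) ≤ ((a⁻¹ : ℝ) : EReal) * r :=
    mul_le_mul_of_nonneg_left (not_lt.1 hr) (by exact_mod_cast (inv_pos.2 ha).le)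
  rw [← EReal.coe_mul, inv_mul_cancel_left₀ ha.ne'] at h1
  exact absurd h (not_lt.2 h1)

theorem mdimCover_le_of_omdimAlong_lt [CompactSpace X] (σ : ℕ → IFSMap X) {α : Set (Set X)}
    (hα : IsOpenCoverOn Set.univ α) {D D' : ℝ} (hD : 0 < D) (hDD' : D < D')
    (h : omdimAlong σ < D) : mdimCover σ α ≤ ENNReal.ofReal D' := by
  obtain ⟨K, g, hK, hgK, hg1, hg0⟩ := exists_lipschitz_of_isOpenCoverOn hα
  have hlim : ∀ B : ℝ, ∀ᶠ ε in 𝓝[>] (0 : ℝ), Real.log ε ≤ -B := fun B =>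
    Real.tendsto_log_nhdsGT_zero.eventually_le_atBot (-B)
  set c := Real.log (8 * K) with hc
  obtain ⟨ε, hε, hε0, hL1, hLc, hLD⟩ := ((frequently_lt_of_liminf_lt (h := h)).and_eventually
    (eventually_mem_nhdsWithin.and ((hlim 1).and ((hlim (c + 1)).and
      (hlim ((α.ncard * Real.log 2 + D' * c) / (D' - D))))))).exists
  replace hε0 : 0 < ε := hε0
  have hLabs : |Real.log ε| = -Real.log ε := abs_of_nonpos (by linarith)
  rw [hLabs] at hε
  set L := -Real.log ε with hL
  have hεL : Real.log ε = -L := by simp [hL]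
  rw [hεL] at hL1 hLc hLD
  have hLpos : 0 < L := by linarith
  have hLD' : L * D + α.ncard * Real.log 2 ≤ D' * (L - c) := by
    have := (div_le_iff₀ (sub_pos.2 hDD')).1 (neg_le_neg_iff.1 hLD)
    linarith
  have h8 : 8 * K * ε ≤ 1 := by
    rw [← Real.log_nonpos_iff (by positivity), Real.log_mul (by positivity) hε0.ne', hεL, ← hc]
    linarith
  set q := ⌊(4 * K * ε)⁻¹⌋₊ with hq
  have h4pos : 0 < 4 * K * ε := by positivity
  have hq_le : (q : ℝ) ≤ (4 * K * ε)⁻¹ := Nat.floor_le (by positivity)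
  have hq_ge : (8 * K * ε)⁻¹ ≤ (q : ℝ) := by
    have h1 : (4 * K * ε)⁻¹ < q + 1 := Nat.lt_floor_add_one _
    have h2 : (4 * K * ε)⁻¹ = 2 * (8 * K * ε)⁻¹ := by field_simp; norm_num
    have h3 : 1 ≤ (8 * K * ε)⁻¹ := (one_le_inv₀ (by positivity)).2 h8
    linarith
  have hq0 : 0 < q := by
    have : (0 : ℝ) < q := lt_of_lt_of_le (by positivity) hq_ge
    exact_mod_cast this
  have hqε : q * (4 * K * ε) ≤ 1 := by
    calc q * (4 * K * ε) ≤ (4 * K * ε)⁻¹ * (4 * K * ε) := by gcongr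
      _ = 1 := inv_mul_cancel₀ h4pos.ne'
  have hlogq : L - c ≤ Real.log q := by
    have := Real.log_le_log (by positivity) hq_ge
    rw [Real.log_inv, Real.log_mul (by positivity) hε0.ne', hεL, ← hc] at this
    linarith
  have hlogq0 : 0 < Real.log q := by linarith
  have hrate := eventually_lt_of_limsup_lt (lt_coe_mul_of_inv_mul_lt hLpos hε)
  refine limsup_le_of_le (h := ?_)
  filter_upwards [(tendsto_add_atTop_nat 1).eventually hrate] with n hn
  have hn0 : (0 : ℝ) < (n : ℝ) + 1 := by positivity
  replace hn := lt_coe_mul_of_inv_mul_lt (by positivity) hn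
  push_cast only [Nat.cast_add, Nat.cast_one] at hn
  set T := ((n : ℝ) + 1) * (L * D) with hT
  have hT0 : 0 ≤ T := by positivity
  have hs : sepNum σ (n + 1) ε ≤ ENNReal.ofReal (Real.exp T) := by
    rw [← ENNReal.log_le_log_iff, ENNReal.log_ofReal_of_pos (Real.exp_pos T), Real.log_exp]
    exact hn.le
  obtain ⟨E, hEN, hE⟩ := exists_spanning_of_sepNum_le σ (n + 1) hε0 (Real.exp_pos T).le hs
  obtain ⟨Z, hZ, hqZ⟩ := exists_coverD_le σ hα.1 hK hgK hg1 hg0 hε0 hq0 hqε n hE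
    (Real.one_le_exp hT0) hEN
  have hZle : (Z : ℝ) ≤ D' * (n + 1) := by
    have h1 := Real.log_le_log (by positivity) hqZ
    rw [Real.log_pow, Real.log_mul (Real.exp_pos T).ne' (by positivity), Real.log_exp,
      Real.log_pow] at h1
    push_cast at h1
    have h2 : (Z : ℝ) * Real.log q ≤ (D' * (n + 1)) * Real.log q := by
      calc (Z : ℝ) * Real.log q ≤ ((n : ℝ) + 1) * (L * D + α.ncard * Real.log 2) := by
            rw [hT] at h1; linarith
        _ ≤ ((n : ℝ) + 1) * (D' * (L - c)) := by gcongr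
        _ ≤ ((n : ℝ) + 1) * (D' * Real.log q) := by
            have : 0 ≤ D' := by linarith
            gcongr
        _ = _ := by ring
    exact le_of_mul_le_mul_right h2 hlogq0
  rw [ENNReal.div_le_iff (by simp) (by finiteness)]
  calc ((coverD (SigmaSet σ) (coverUpTo σ α n) : ℕ∞) : ℝ≥0∞) ≤ ((Z : ℕ∞) : ℝ≥0∞) := by
        exact_mod_cast hZ
    _ = ENNReal.ofReal (Z : ℝ) := by simp
    _ ≤ ENNReal.ofReal (D' * (n + 1)) := ENNReal.ofReal_le_ofReal hZle
    _ = _ := by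
        rw [ENNReal.ofReal_mul (by linarith), ENNReal.ofReal_add (by positivity) zero_le_one]
        simp

theorem omdimAlong_nonneg {σ : ℕ → IFSMap X} (hσ : (SigmaSet σ).Nonempty) : 0 ≤ omdimAlong σ := by
  obtain ⟨x, hx⟩ := hσ
  have hs : ∀ n ε, 1 ≤ sepNum σ n ε := fun n ε => by
    have := le_iSup₂ (f := fun (S : Set X) (_ : IsSeparatedAlong σ n ε S) => (S.encard : ℝ≥0∞))
      {x} ⟨by rintro _ rfl; exact hx, by rintro _ rfl _ rfl h; exact absurd rfl h⟩
    simpa [sepNum] using this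
  refine le_liminf_of_le (h := Eventually.of_forall fun ε => ?_)
  refine mul_nonneg (by exact_mod_cast inv_nonneg.2 (abs_nonneg _)) ?_
  refine le_limsup_of_frequently_le (Frequently.of_forall fun n => ?_)
  exact mul_nonneg (by exact_mod_cast inv_nonneg.2 (Nat.cast_nonneg n))
    (ENNReal.zero_le_log_iff.2 (hs n ε))

theorem IsIFS.exists_nonempty_sigmaSet {𝔙 : Set (IFSMap X)} (h : IsIFS 𝔙) :
    ∃ σ, SeqIn 𝔙 σ ∧ (SigmaSet σ).Nonempty := by
  obtain ⟨O, ⟨y, hy⟩, hO⟩ := h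
  simp only [mem_iUnion, exists_prop] at hy
  obtain ⟨v₀, hv₀, x₀, hx₀, -⟩ := hy
  let S := {p : X × IFSMap X // p.2 ∈ 𝔙 ∧ p.1 ∈ p.2.dom ∩ O}
  have step : ∀ p : S, ∃ p' : S, p'.1.1 = p.1.2.toFun p.1.1 := by
    rintro ⟨⟨x, v⟩, hv, hx⟩
    have : v.toFun x ∈ ⋃ v ∈ 𝔙, (v.dom ∩ O) := hO (mem_biUnion hv ⟨x, hx, rfl⟩)
    simp only [mem_iUnion, exists_prop] at this
    obtain ⟨w, hw, hxw⟩ := this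
    exact ⟨⟨(v.toFun x, w), hw, hxw⟩, rfl⟩
  choose f hf using step
  let s : ℕ → S := fun n => f^[n] ⟨(x₀, v₀), hv₀, hx₀⟩
  have horb : ∀ n, orbitIter (fun n => (s n).1.2) x₀ n = (s n).1.1 := by
    intro n
    induction n with
    | zero => rfl
    | succ n ih =>
      have : s (n + 1) = f (s n) := Function.iterate_succ_apply' _ _ _
      rw [this, hf, orbitIter, ih]
  exact ⟨fun n => (s n).1.2, fun n => (s n).2.1, x₀, fun n => by rw [horb]; exact (s n).2.2.1⟩

theorem mdimCover_le_omdim [CompactSpace X] {𝔙 : Set (IFSMap X)} (h𝔙 : 0 ≤ omdim 𝔙)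
    {σ : ℕ → IFSMap X} (hσ : SeqIn 𝔙 σ) {α : Set (Set X)} (hα : IsOpenCoverOn Set.univ α) :
    mdimCover σ α ≤ (omdim 𝔙).toENNReal := by
  refine le_of_forall_gt_imp_ge_of_dense fun a ha => ?_
  induction a using ENNReal.recTopCoe with
  | top => exact le_top
  | coe a =>
    have ha' : omdim 𝔙 < ((a : ℝ) : EReal) := by
      rw [← EReal.coe_toENNReal h𝔙]
      exact EReal.coe_ennreal_lt_coe_ennreal_iff.2 ha
    obtain ⟨D, hD, hDa⟩ := EReal.lt_iff_exists_real_btwn.1 ha'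
    have h1 : omdimAlong σ < D :=
      (le_iSup₂ (f := fun (σ : ℕ → IFSMap X) (_ : SeqIn 𝔙 σ) => omdimAlong σ) σ hσ).trans_lt hD
    rw [← ENNReal.ofReal_coe_nnreal]
    exact mdimCover_le_of_omdimAlong_lt σ hα (by exact_mod_cast h𝔙.trans_lt hD)
      (by exact_mod_cast hDa) h1

end IFS

open IFS in
/-- Mean dimension is bounded by the orbit metric mean dimension. -/
theorem mdim_le_omdim {X : Type*} [MetricSpace X] [CompactSpace X]
    (𝔙 : Set (IFSMap X)) (hIFS : IsIFS 𝔙) :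
    (mdim 𝔙 : EReal) ≤ omdim 𝔙 := by
  obtain ⟨σ₀, hσ₀, hne⟩ := hIFS.exists_nonempty_sigmaSet
  have h0 : 0 ≤ omdim 𝔙 := (omdimAlong_nonneg hne).trans
    (le_iSup₂ (f := fun (σ : ℕ → IFSMap X) (_ : SeqIn 𝔙 σ) => omdimAlong σ) σ₀ hσ₀)
  rw [← EReal.coe_toENNReal h0, EReal.coe_ennreal_le_coe_ennreal_iff]
  exact iSup₂_le fun σ hσ => iSup₂_le fun α hα => mdimCover_le_omdim h0 hσ hα
end
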